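/- Let k be an algebraically closed field of characteristic zero, n ≥ 4 and d ≥ 1. Set t = ⌊C(d+n,n)/(d+1)⌋ and t* = ⌈C(d+n,n)/(d+1)⌉; note t ≥ 2(d−1). Then there exist in P^n sundials Ĉ_1,…,Ĉ_{d−1} and lines M_1,…,M_{t−2(d−1)} whose combined ideal I satisfies dim (I)_d = C(d+n,n) − t(d+1); and there exist sundials Ĉ_1,…,Ĉ_{d−1} and lines M_1,…,M_{t*−2(d−1)} whose combined ideal I* satisfies dim (I*)_d = 0. (I.e., statements S(n,d) and S*(n,d) hold for all n ≥ 4.) -/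

import Mathlib

open MvPolynomial

noncomputable def vanIdeal (k : Type) [Field k] (N : ℕ) (V : Set (Fin N → k)) :
    Ideal (MvPolynomial (Fin N) k) where
  carrier := {f | ∀ v ∈ V, MvPolynomial.eval v f = 0}
  add_mem' := by
    intro f g hf hg v hv
    simp only [Set.mem_setOf_eq] at *
    simp [map_add, hf v hv, hg v hv]
  zero_mem' := by
    intro v hv
    simp
  smul_mem' := by
    intro c f hf v hv
    simp only [Set.mem_setOf_eq] at *
    simp [smul_eq_mul, hf v hv]

noncomputable def hdim (k : Type) [Field k] (N : ℕ)
    (I : Ideal (MvPolynomial (Fin N) k)) (d : ℕ) : ℕ :=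
  Module.finrank k
    ↥(Submodule.restrictScalars k
        (I : Submodule (MvPolynomial (Fin N) k) (MvPolynomial (Fin N) k))
      ⊓ MvPolynomial.homogeneousSubmodule (Fin N) k d)

/-- A 3-dimensional sundial: two distinct lines `V₁ ≠ V₂` meeting in a point
`P = V₁ ⊓ V₂`, together with a 4-dimensional subspace `T ⊇ V₁ ⊔ V₂`. -/
def IsSundial (k : Type) [Field k] (N : ℕ)
    (V₁ V₂ T : Submodule k (Fin N → k)) : Prop :=
  Module.finrank k V₁ = 2 ∧ Module.finrank k V₂ = 2 ∧ V₁ ≠ V₂ ∧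
    Module.finrank k ↥(V₁ ⊓ V₂) = 1 ∧ V₁ ⊔ V₂ ≤ T ∧ Module.finrank k T = 4

/-- The ideal `I(V₁) ∩ I(V₂) ∩ (I(P)² + I(T))` of a 3-dimensional sundial. -/
noncomputable def sundialIdeal (k : Type) [Field k] (N : ℕ)
    (V₁ V₂ T : Submodule k (Fin N → k)) : Ideal (MvPolynomial (Fin N) k) :=
  vanIdeal k N ↑V₁ ⊓ vanIdeal k N ↑V₂ ⊓
    ((vanIdeal k N ↑(V₁ ⊓ V₂)) ^ 2 + vanIdeal k N ↑T)



section generic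

variable {k : Type} [Field k]

/-- polynomial functions in one variable -/
def PolyFun (f : k → k) : Prop := ∃ p : Polynomial k, ∀ x, f x = p.eval x

/-- functions on a vector space which are polynomial along lines -/
def PolyOn (k : Type) [Field k] {E : Type} [AddCommGroup E] [Module k E] (f : E → k) : Prop :=
  ∀ x y : E, PolyFun fun l : k => f (x + l • y)

/-- sets whose complement meets every line through a point of the set in a finite set -/
def LOpen (k : Type) [Field k] {E : Type} [AddCommGroup E] [Module k E] (P : Set E) : Prop :=
  ∀ x y : E, x ∈ P → {l : k | x + l • y ∉ P}.Finite

variable {E E' : Type} [AddCommGroup E] [Module k E] [AddCommGroup E'] [Module k E']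

lemma PolyOn.const (c : k) : PolyOn k (fun _ : E => c) :=
  fun _ _ => ⟨Polynomial.C c, by simp⟩

lemma PolyOn.add {f g : E → k} (hf : PolyOn k f) (hg : PolyOn k g) :
    PolyOn k (fun e => f e + g e) := by
  intro x y
  obtain ⟨p, hp⟩ := hf x y
  obtain ⟨q, hq⟩ := hg x y
  exact ⟨p + q, fun l => by simp [← hp, ← hq]⟩

lemma PolyOn.mul {f g : E → k} (hf : PolyOn k f) (hg : PolyOn k g) :
    PolyOn k (fun e => f e * g e) := by
  intro x y
  obtain ⟨p, hp⟩ := hf x y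
  obtain ⟨q, hq⟩ := hg x y
  exact ⟨p * q, fun l => by simp [← hp, ← hq]⟩

lemma PolyOn.sub {f g : E → k} (hf : PolyOn k f) (hg : PolyOn k g) :
    PolyOn k (fun e => f e - g e) := by
  intro x y
  obtain ⟨p, hp⟩ := hf x y
  obtain ⟨q, hq⟩ := hg x y
  exact ⟨p - q, fun l => by simp [← hp, ← hq]⟩

lemma PolyOn.sum {α : Type} (s : Finset α) {f : α → E → k} (hf : ∀ a ∈ s, PolyOn k (f a)) :
    PolyOn k (fun e => ∑ a ∈ s, f a e) := by
  classical
  induction s using Finset.induction_on with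
  | empty => simpa using PolyOn.const (E := E) (0 : k)
  | insert a s ha ih =>
    simp only [Finset.sum_insert ha]
    exact (hf a (by simp)).add (ih fun b hb => hf b (by simp [hb]))

lemma PolyOn.lin (f : E →ₗ[k] k) : PolyOn k (fun e => f e) := by
  intro x y
  exact ⟨Polynomial.C (f x) + Polynomial.X * Polynomial.C (f y), fun l => by simp; ring⟩

lemma PolyOn.comp {f : E → k} (hf : PolyOn k f) (T : E' →ₗ[k] E) :
    PolyOn k (fun e => f (T e)) := by
  intro x y
  obtain ⟨p, hp⟩ := hf (T x) (T y)
  exact ⟨p, fun l => by simp [← hp]⟩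

lemma PolyOn.evalMv {σ : Type} {f : σ → E → k} (hf : ∀ i, PolyOn k (f i))
    (F : MvPolynomial σ k) : PolyOn k (fun e => MvPolynomial.eval (fun i => f i e) F) := by
  induction F using MvPolynomial.induction_on with
  | C a => simpa using PolyOn.const a
  | add p q hp hq => simpa using hp.add hq
  | mul_X p i hp => simpa using hp.mul (hf i)

lemma LOpen.inter {P Q : Set E} (hP : LOpen k P) (hQ : LOpen k Q) : LOpen k (P ∩ Q) := by
  intro x y hx
  refine ((hP x y hx.1).union (hQ x y hx.2)).subset ?_
  intro l hl
  simp only [Set.mem_ofPred_eq, Set.mem_inter_iff, not_and_or, Set.mem_union] at hl ⊢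
  exact hl

lemma LOpen.iInter {α : Type} [Finite α] {P : α → Set E} (hP : ∀ a, LOpen k (P a)) :
    LOpen k (⋂ a, P a) := by
  intro x y hx
  refine (Set.finite_iUnion fun a => hP a x y (Set.mem_iInter.1 hx a)).subset ?_
  intro l hl
  simpa using hl

lemma LOpen.comap {P : Set E} (hP : LOpen k P) (T : E' →ₗ[k] E) : LOpen k {e | T e ∈ P} := by
  intro x y hx
  simpa using hP (T x) (T y) hx

lemma LOpen.ne_zero {f : E → k} (hf : PolyOn k f) : LOpen k {e | f e ≠ 0} := by
  intro x y hx
  obtain ⟨p, hp⟩ := hf x y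
  have h0 : p ≠ 0 := by
    rintro rfl
    apply hx
    simpa using hp 0
  refine (Polynomial.finite_setOfPred_isRoot h0).subset ?_
  intro l hl
  simpa [← hp] using hl

lemma LOpen.nonempty_inter [Infinite k] {P Q : Set E} (hP : LOpen k P) (hQ : LOpen k Q)
    (h1 : P.Nonempty) (h2 : Q.Nonempty) : (P ∩ Q).Nonempty := by
  obtain ⟨x, hx⟩ := h1
  obtain ⟨y, hy⟩ := h2
  have f1 := hP x (y - x) hx
  have f2 := (hQ y (x - y) hy).image (fun l => 1 - l)
  obtain ⟨l, hl⟩ := (f1.union f2).exists_notMem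
  simp only [Set.mem_union, not_or] at hl
  refine ⟨x + l • (y - x), ?_, ?_⟩
  · by_contra h; exact hl.1 h
  · by_contra h
    apply hl.2
    refine ⟨1 - l, ?_, by ring⟩
    have : y + (1 - l) • (x - y) = x + l • (y - x) := by module
    simpa [this] using h

lemma nonempty_iInter_aux [Infinite k] {α : Type} [Finite α] {P : α → Set E}
    (hP : ∀ a, LOpen k (P a)) (h : ∀ a, (P a).Nonempty) : (⋂ a, P a).Nonempty := by
  classical
  cases nonempty_fintype α
  have key : ∀ s : Finset α, LOpen k (⋂ a ∈ s, P a) ∧ (⋂ a ∈ s, P a).Nonempty := by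
    intro s
    induction s using Finset.induction_on with
    | empty =>
      refine ⟨?_, by simp⟩
      intro x y _
      simp
    | insert a s ha ih =>
      simp only [Finset.set_biInter_insert]
      exact ⟨(hP a).inter ih.1, (hP a).nonempty_inter ih.1 (h a) ih.2⟩
  simpa using (key Finset.univ).2

open Module in
lemma exists_dual_vectors {M : Type} [AddCommGroup M] [Module k M] [FiniteDimensional k M]
    {r : ℕ} (f : Fin r → (M →ₗ[k] k)) (hf : LinearIndependent k f) :
    Function.Surjective (LinearMap.pi f) := by
  by_contra hcon
  rw [← LinearMap.range_eq_top] at hcon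
  obtain ⟨g, hg0, hg⟩ := Submodule.exists_le_ker_of_lt_top _ (lt_top_iff_ne_top.2 hcon)
  apply hg0
  rw [Fintype.linearIndependent_iff] at hf
  have hz := hf (fun i => g (Pi.single i 1)) (by
    ext v
    have : g (LinearMap.pi f v) = 0 := hg ⟨v, rfl⟩
    rw [LinearMap.pi_apply_eq_sum_univ g] at this
    have hs : ∀ i : Fin r, (fun j => if i = j then (1 : k) else 0) = Pi.single i 1 := by
      intro i
      ext j
      simp [Pi.single_apply, eq_comm]
    simp only [hs] at this
    simpa [mul_comm] using this)
  apply LinearMap.pi_ext'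
  intro i
  ext
  simpa using hz i

open Module in
lemma LOpen.rank {M : Type} [AddCommGroup M] [Module k M] [FiniteDimensional k M]
    {Λ : Type} (Φ : E → Λ → (M →ₗ[k] k)) (h : ∀ l v, PolyOn k (fun e => Φ e l v)) (b : ℕ) :
    LOpen k {e | finrank k ↥(⨅ l, LinearMap.ker (Φ e l)) ≤ b} := by
  classical
  intro x y hx
  -- the span of the functionals
  set S : Submodule k (Dual k M) := Submodule.span k (Set.range (Φ x)) with hS
  have hco : S.dualCoannihilator = ⨅ l, LinearMap.ker (Φ x l) := by
    ext v
    simp only [Submodule.mem_dualCoannihilator, Submodule.mem_iInf, LinearMap.mem_ker]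
    constructor
    · intro hv l
      exact hv _ (Submodule.subset_span ⟨l, rfl⟩)
    · intro hv φ hφ
      induction hφ using Submodule.span_induction with
      | mem φ hφ => obtain ⟨l, rfl⟩ := hφ; exact hv l
      | zero => simp
      | add a b _ _ ha hb => simp [ha, hb]
      | smul c a _ ha => simp [ha]
  have hdim : finrank k S + finrank k ↥(⨅ l, LinearMap.ker (Φ x l)) = finrank k M := by
    rw [← hco]
    exact Subspace.finrank_add_finrank_dualCoannihilator_eq S
  obtain ⟨r, f, l, hl, hfi, hdim⟩ : ∃ (r : ℕ) (f : Fin r → (M →ₗ[k] k)) (l : Fin r → Λ),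
      (∀ i, Φ x (l i) = f i) ∧ LinearIndependent k f ∧
      r + finrank k ↥(⨅ l, LinearMap.ker (Φ x l)) = finrank k M := by
    obtain ⟨f, hfm, hfs, hfi⟩ := Submodule.exists_fun_fin_finrank_span_eq k (Set.range (Φ x))
    choose l hl using hfm
    exact ⟨_, f, l, hl, hfi, hdim⟩
  have hsurj := exists_dual_vectors f hfi
  choose v hv using fun j : Fin r => hsurj (Pi.single j 1)
  have hpoly : PolyOn k (fun e => (Matrix.of fun i j : Fin r => Φ e (l i) (v j)).det) := by
    simp only [Matrix.det_apply']
    apply PolyOn.sum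
    intro σ _
    apply (PolyOn.const _).mul
    have : ∀ s : Finset (Fin r), PolyOn k (fun e => ∏ i ∈ s,
        (Matrix.of fun i j : Fin r => Φ e (l i) (v j)) (σ i) i) := by
      intro s
      induction s using Finset.induction_on with
      | empty => simpa using PolyOn.const (1 : k)
      | insert a s ha ih =>
        simp only [Finset.prod_insert ha]
        exact (h _ _).mul ih
    exact this _
  refine (LOpen.ne_zero hpoly x y ?_).subset ?_
  · have : (Matrix.of fun i j : Fin r => Φ x (l i) (v j)) = 1 := by
      ext i j
      have := congrFun (hv j) i
      simp only [LinearMap.pi_apply] at this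
      simp [hl, this, Matrix.one_apply, Pi.single_apply]
    simp [this]
  · intro t ht
    simp only [Set.mem_ofPred_eq, not_le] at ht ⊢
    intro hdet
    apply absurd ht
    rw [not_lt]
    set e := x + t • y
    let P : M →ₗ[k] (Fin r → k) := LinearMap.pi fun i => Φ e (l i)
    have hPs : LinearMap.range P = ⊤ := by
      rw [LinearMap.range_eq_top]
      intro w
      have hu : IsUnit (Matrix.of fun i j : Fin r => Φ e (l i) (v j)) := by
        rw [Matrix.isUnit_iff_isUnit_det]
        exact isUnit_iff_ne_zero.2 hdet
      obtain ⟨c, hc⟩ := (Matrix.mulVec_surjective_iff_isUnit.2 hu) w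
      refine ⟨∑ j, c j • v j, ?_⟩
      rw [← hc]
      ext i
      simp [P, Matrix.mulVec, dotProduct, mul_comm]
    have h1 := LinearMap.finrank_range_add_finrank_ker P
    rw [hPs, finrank_top, finrank_fin_fun] at h1
    have h2 : finrank k ↥(⨅ l, LinearMap.ker (Φ e l)) ≤ finrank k (LinearMap.ker P) := by
      apply Submodule.finrank_mono
      intro w hw
      simp only [Submodule.mem_iInf, LinearMap.mem_ker] at hw ⊢
      ext i
      simp [P, hw]
    have hx' : finrank k ↥(⨅ l, LinearMap.ker (Φ x l)) ≤ b := hx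
    omega

open Module in
/-- adding general points -/
lemma exists_points {M : Type} [AddCommGroup M] [Module k M] [FiniteDimensional k M]
    {Ω : Type} [Nonempty Ω] (ev : Ω → (M →ₗ[k] k)) (V : Submodule k M)
    (hV : ∀ v ∈ V, (∀ ω, ev ω v = 0) → v = 0) (α : Type) [Fintype α] :
    ∃ w : α → Ω, finrank k ↥(V ⊓ ⨅ a, LinearMap.ker (ev (w a))) ≤ finrank k V - Fintype.card α := by
  classical
  have key : ∀ r : ℕ, ∃ w : Fin r → Ω,
      finrank k ↥(V ⊓ ⨅ a, LinearMap.ker (ev (w a))) ≤ finrank k V - r := by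
    intro r
    induction r with
    | zero => exact ⟨Fin.elim0, by simpa using Submodule.finrank_mono inf_le_left⟩
    | succ r ih =>
      obtain ⟨w, hw⟩ := ih
      set U := V ⊓ ⨅ a, LinearMap.ker (ev (w a)) with hU
      by_cases h0 : U = ⊥
      · refine ⟨Fin.snoc w (Classical.arbitrary Ω), ?_⟩
        have : V ⊓ ⨅ a, LinearMap.ker (ev ((Fin.snoc w (Classical.arbitrary Ω) : Fin (r+1) → Ω) a)) ≤ U := by
          intro v hv
          simp only [Submodule.mem_inf, Submodule.mem_iInf, hU] at hv ⊢
          exact ⟨hv.1, fun a => by simpa using hv.2 a.castSucc⟩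
        rw [h0, le_bot_iff] at this
        rw [this]
        simp
      · obtain ⟨v, hvU, hv0⟩ := Submodule.exists_mem_ne_zero_of_ne_bot h0
        have : ∃ ω, ev ω v ≠ 0 := by
          by_contra hc
          push Not at hc
          exact hv0 (hV v hvU.1 hc)
        obtain ⟨ω, hω⟩ := this
        refine ⟨Fin.snoc w ω, ?_⟩
        have : V ⊓ ⨅ a, LinearMap.ker (ev ((Fin.snoc w ω : Fin (r+1) → Ω) a)) < U := by
          refine lt_of_le_of_ne ?_ ?_
          · intro v hv
            simp only [Submodule.mem_inf, Submodule.mem_iInf, hU] at hv ⊢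
            exact ⟨hv.1, fun a => by simpa using hv.2 a.castSucc⟩
          · intro heq
            rw [← heq] at hvU
            simp only [Submodule.mem_inf, Submodule.mem_iInf, LinearMap.mem_ker] at hvU
            exact hω (by simpa using hvU.2 (Fin.last r))
        have := Submodule.finrank_lt_finrank_of_lt this
        omega
  obtain ⟨w, hw⟩ := key (Fintype.card α)
  let e := Fintype.equivFin α
  refine ⟨fun a => w (e a), ?_⟩
  have : ⨅ a, LinearMap.ker (ev (w (e a))) = ⨅ a, LinearMap.ker (ev (w a)) :=
    e.iInf_comp (g := fun a => LinearMap.ker (ev (w a)))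
  rw [this]
  exact hw

open Module in
/-- dropping finitely many linear conditions -/
lemma finrank_drop {M : Type} [AddCommGroup M] [Module k M] [FiniteDimensional k M]
    {α : Type} [Fintype α] (φ : α → (M →ₗ[k] k)) (V U : Submodule k M)
    (hU : ∀ v ∈ V, (∀ a, φ a v = 0) → v ∈ U) :
    finrank k V ≤ finrank k U + Fintype.card α := by
  let P : V →ₗ[k] (α → k) := (LinearMap.pi φ).comp V.subtype
  have h1 := LinearMap.finrank_range_add_finrank_ker P
  have h2 : finrank k (LinearMap.range P) ≤ Fintype.card α := by
    simpa using Submodule.finrank_le (LinearMap.range P)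
  have h3 : finrank k (LinearMap.ker P) ≤ finrank k U := by
    have : (LinearMap.ker P).map V.subtype ≤ U := by
      rintro _ ⟨v, hv, rfl⟩
      refine hU _ v.2 fun a => ?_
      simpa [P] using congrFun (LinearMap.mem_ker.1 hv) a
    rw [(Submodule.equivMapOfInjective V.subtype V.injective_subtype (LinearMap.ker P)).finrank_eq]
    exact Submodule.finrank_mono this
  omega

end generic

section forms

variable {k : Type} [Field k] {N : ℕ}

/-- forms of degree `d` -/
abbrev Rf (k : Type) [Field k] (N d : ℕ) : Type := ↥(homogeneousSubmodule (Fin N) k d)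

instance Rf_finite (d : ℕ) : FiniteDimensional k (Rf k N d) :=
  Module.Finite.iff_fg.2 (homogeneousSubmodule_fg (σ := Fin N) (R := k) d)

/-- directional derivative at `p` in direction `c` -/
noncomputable def dv (p c : Fin N → k) : MvPolynomial (Fin N) k →ₗ[k] k where
  toFun F := ∑ i, c i * eval p (pderiv i F)
  map_add' F G := by simp [mul_add, Finset.sum_add_distrib]
  map_smul' r F := by
    simp only [Derivation.map_smul, smul_eval, RingHom.id_apply, smul_eq_mul, Finset.mul_sum]
    exact Finset.sum_congr rfl fun i _ => by ring

lemma dv_apply (p c : Fin N → k) (F : MvPolynomial (Fin N) k) :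
    dv p c F = ∑ i, c i * eval p (pderiv i F) := rfl

lemma dv_mul (p c : Fin N → k) (F G : MvPolynomial (Fin N) k) :
    dv p c (F * G) = dv p c F * eval p G + eval p F * dv p c G := by
  simp only [dv_apply, Derivation.leibniz, map_add, smul_eq_mul, map_mul, Finset.sum_mul,
    Finset.mul_sum, ← Finset.sum_add_distrib]
  exact Finset.sum_congr rfl fun i _ => by ring

lemma dv_C (p c : Fin N → k) (r : k) : dv p c (C r) = 0 := by simp [dv_apply]

lemma dv_X (p c : Fin N → k) (i : Fin N) : dv p c (X i) = c i := by
  simp [dv_apply, pderiv_X, Pi.single_apply, apply_ite]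

/-- evaluation as a linear map -/
noncomputable def evL (p : Fin N → k) : MvPolynomial (Fin N) k →ₗ[k] k where
  toFun F := eval p F
  map_add' F G := by simp
  map_smul' r F := by simp [smul_eval]

/-- vanishing on the line spanned by `a`, `b` -/
def vl (F : MvPolynomial (Fin N) k) (a b : Fin N → k) : Prop :=
  ∀ s t : k, eval (s • a + t • b) F = 0

lemma vl.span {F : MvPolynomial (Fin N) k} {a b : Fin N → k} (h : vl F a b) {a' b' : Fin N → k}
    {x y z w : k} (h1 : a' = x • a + y • b) (h2 : b' = z • a + w • b) : vl F a' b' := by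
  intro s t
  have := h (s * x + t * z) (s * y + t * w)
  rw [← this, h1, h2]
  congr 2
  module

lemma vl.left {F : MvPolynomial (Fin N) k} {a b : Fin N → k} (h : vl F a b) : eval a F = 0 := by
  simpa using h 1 0

lemma vl.right {F : MvPolynomial (Fin N) k} {a b : Fin N → k} (h : vl F a b) : eval b F = 0 := by
  simpa using h 0 1

/-- the system of forms vanishing on lines, along tangent vectors and at points -/
def K (d : ℕ) {κ τ π : Type} (a b : κ → Fin N → k) (p c : τ → Fin N → k) (w : π → Fin N → k) :
    Submodule k (Rf k N d) where
  carrier := {F | (∀ j, vl F.1 (a j) (b j)) ∧ (∀ i, dv (p i) (c i) F.1 = 0) ∧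
    ∀ l, eval (w l) F.1 = 0}
  add_mem' := by
    rintro F G ⟨h1, h2, h3⟩ ⟨g1, g2, g3⟩
    refine ⟨fun j s t => ?_, fun i => ?_, fun l => ?_⟩
    · simp [h1 j s t, g1 j s t]
    · simp [h2 i, g2 i]
    · simp [h3 l, g3 l]
  zero_mem' := ⟨fun j s t => by simp, fun i => by simp, fun l => by simp⟩
  smul_mem' := by
    rintro r F ⟨h1, h2, h3⟩
    refine ⟨fun j s t => ?_, fun i => ?_, fun l => ?_⟩
    · simp [h1 j s t, smul_eval]
    · simp [h2 i]
    · simp [h3 l, smul_eval]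

lemma mem_K {d : ℕ} {κ τ π : Type} {a b : κ → Fin N → k} {p c : τ → Fin N → k}
    {w : π → Fin N → k} {F : Rf k N d} : F ∈ K d a b p c w ↔
    (∀ j, vl F.1 (a j) (b j)) ∧ (∀ i, dv (p i) (c i) F.1 = 0) ∧ ∀ l, eval (w l) F.1 = 0 :=
  Iff.rfl

open Module in
lemma LOpen_K {E : Type} [AddCommGroup E] [Module k E] (d : ℕ) {κ τ π : Type}
    {a b : E → κ → Fin N → k} {p c : E → τ → Fin N → k} {w : E → π → Fin N → k}
    (ha : ∀ j i, PolyOn k fun e => a e j i) (hb : ∀ j i, PolyOn k fun e => b e j i)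
    (hp : ∀ j i, PolyOn k fun e => p e j i) (hc : ∀ j i, PolyOn k fun e => c e j i)
    (hw : ∀ j i, PolyOn k fun e => w e j i) (n : ℕ) :
    LOpen k {e | finrank k (K d (a e) (b e) (p e) (c e) (w e)) ≤ n} := by
  let Φ : E → (κ × k × k ⊕ τ ⊕ π) → (Rf k N d →ₗ[k] k) := fun e l =>
    (Sum.elim (fun j => evL (j.2.1 • a e j.1 + j.2.2 • b e j.1))
      (Sum.elim (fun i => dv (p e i) (c e i)) (fun i => evL (w e i))) l).comp
      (Submodule.subtype _)
  have hK : ∀ e, K d (a e) (b e) (p e) (c e) (w e) = ⨅ l, LinearMap.ker (Φ e l) := by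
    intro e
    ext F
    simp [mem_K, Φ, iInf_sum, iInf_prod, vl, evL]
  have hs : {e | finrank k (K d (a e) (b e) (p e) (c e) (w e)) ≤ n} =
      {e | finrank k ↥(⨅ l, LinearMap.ker (Φ e l)) ≤ n} := by
    ext e
    change finrank k _ ≤ n ↔ finrank k _ ≤ n
    rw [hK e]
  rw [hs]
  apply LOpen.rank
  rintro (⟨j, s, t⟩ | i | i) F
  · change PolyOn k fun e => eval (s • a e j + t • b e j) F.1
    have : ∀ e, s • a e j + t • b e j = fun i => s * a e j i + t * b e j i := fun e => rfl
    simp only [this]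
    exact PolyOn.evalMv (fun i => ((PolyOn.const s).mul (ha j i)).add
      ((PolyOn.const t).mul (hb j i))) _
  · change PolyOn k fun e => ∑ l, c e i l * eval (p e i) (pderiv l F.1)
    exact PolyOn.sum _ fun l _ => (hc i l).mul (PolyOn.evalMv (fun m => hp i m) _)
  · exact PolyOn.evalMv (fun m => hw i m) _

/-- forms vanishing on sundials and lines -/
def KS (d : ℕ) {ι κ : Type} (S : Fin 4 → ι → Fin N → k) (L : Fin 2 → κ → Fin N → k) :
    Submodule k (Rf k N d) :=
  K d (Sum.elim (S 0) (Sum.elim (S 0) (L 0))) (Sum.elim (S 1) (Sum.elim (S 2) (L 1)))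
    (S 0) (S 3) (Empty.elim : Empty → Fin N → k)

lemma mem_KS {d : ℕ} {ι κ : Type} {S : Fin 4 → ι → Fin N → k} {L : Fin 2 → κ → Fin N → k}
    {F : Rf k N d} : F ∈ KS d S L ↔
    (∀ i, vl F.1 (S 0 i) (S 1 i)) ∧ (∀ i, vl F.1 (S 0 i) (S 2 i)) ∧
    (∀ j, vl F.1 (L 0 j) (L 1 j)) ∧ (∀ i, dv (S 0 i) (S 3 i) F.1 = 0) := by
  simp [KS, mem_K, and_assoc]

open Module in
/-- some configuration of sundials and lines has at most the given postulation defect -/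
def Good (k : Type) [Field k] (N d : ℕ) (ι κ : Type) (b : ℕ) : Prop :=
  ∃ (S : Fin 4 → ι → Fin N → k) (L : Fin 2 → κ → Fin N → k), finrank k (KS d S L) ≤ b

lemma Good.equiv {d : ℕ} {ι κ ι' κ' : Type} {b b' : ℕ} (h : Good k N d ι κ b) (e : ι' ≃ ι)
    (f : κ' ≃ κ) (hb : b ≤ b') : Good k N d ι' κ' b' := by
  obtain ⟨S, L, h⟩ := h
  refine ⟨fun i => S i ∘ e, fun i => L i ∘ f, le_trans (Submodule.finrank_mono ?_) (h.trans hb)⟩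
  intro F hF
  rw [mem_KS] at hF ⊢
  refine ⟨fun i => ?_, fun i => ?_, fun i => ?_, fun i => ?_⟩
  · simpa using hF.1 (e.symm i)
  · simpa using hF.2.1 (e.symm i)
  · simpa using hF.2.2.1 (f.symm i)
  · simpa using hF.2.2.2 (e.symm i)

/-- numbers instead of types -/
def GoodN (k : Type) [Field k] (N d m l b : ℕ) : Prop := Good k N d (Fin m) (Fin l) b

lemma Good.toN {d : ℕ} {ι κ : Type} [Fintype ι] [Fintype κ] {b b' m l : ℕ}
    (h : Good k N d ι κ b) (h1 : Fintype.card ι = m) (h2 : Fintype.card κ = l) (hb : b ≤ b') :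
    GoodN k N d m l b' :=
  h.equiv (Fintype.equivFinOfCardEq h1).symm (Fintype.equivFinOfCardEq h2).symm hb

lemma GoodN.toT {d : ℕ} {b m l : ℕ} (h : GoodN k N d m l b) (ι κ : Type) [Fintype ι] [Fintype κ]
    (h1 : Fintype.card ι = m) (h2 : Fintype.card κ = l) :
    Good k N d ι κ b :=
  Good.equiv h (Fintype.equivFinOfCardEq h1) (Fintype.equivFinOfCardEq h2) le_rfl

lemma LOpen_KS (d : ℕ) (ι κ : Type) (n : ℕ) :
    LOpen k {e : (Fin 4 → ι → Fin N → k) × (Fin 2 → κ → Fin N → k) |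
      Module.finrank k (KS d e.1 e.2) ≤ n} := by
  have hS : ∀ (a : Fin 4) (i : ι) (x : Fin N), PolyOn k
      fun e : (Fin 4 → ι → Fin N → k) × (Fin 2 → κ → Fin N → k) => e.1 a i x := fun a i x =>
    PolyOn.lin ((LinearMap.proj x).comp ((LinearMap.proj i).comp ((LinearMap.proj a).comp
      (LinearMap.fst k (Fin 4 → ι → Fin N → k) (Fin 2 → κ → Fin N → k)))))
  have hL : ∀ (a : Fin 2) (i : κ) (x : Fin N), PolyOn k
      fun e : (Fin 4 → ι → Fin N → k) × (Fin 2 → κ → Fin N → k) => e.2 a i x := fun a i x =>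
    PolyOn.lin ((LinearMap.proj x).comp ((LinearMap.proj i).comp ((LinearMap.proj a).comp
      (LinearMap.snd k (Fin 4 → ι → Fin N → k) (Fin 2 → κ → Fin N → k)))))
  apply LOpen_K
  · rintro (i | i | i) x
    exacts [hS _ _ _, hS _ _ _, hL _ _ _]
  · rintro (i | i | i) x
    exacts [hS _ _ _, hS _ _ _, hL _ _ _]
  · exact fun i x => hS _ _ _
  · exact fun i x => hS _ _ _
  · exact fun i => i.elim

open Module in
lemma horace {M M' M'' : Type} [AddCommGroup M] [Module k M] [FiniteDimensional k M]
    [AddCommGroup M'] [Module k M'] [FiniteDimensional k M']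
    [AddCommGroup M''] [Module k M''] [FiniteDimensional k M'']
    (T : M →ₗ[k] M') (S : M'' →ₗ[k] M) (V : Submodule k M) (V' : Submodule k M')
    (V'' : Submodule k M'') (h1 : ∀ v ∈ V, T v ∈ V')
    (h2 : ∀ v ∈ V, T v = 0 → ∃ u ∈ V'', S u = v) :
    finrank k V ≤ finrank k V' + finrank k V'' := by
  let P : V →ₗ[k] M' := T.comp V.subtype
  have e1 := LinearMap.finrank_range_add_finrank_ker P
  have e2 : finrank k (LinearMap.range P) ≤ finrank k V' := by
    apply Submodule.finrank_mono
    rintro _ ⟨v, rfl⟩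
    exact h1 _ v.2
  have e3 : finrank k (LinearMap.ker P) ≤ finrank k V'' := by
    have : (LinearMap.ker P).map V.subtype ≤ V''.map S := by
      rintro _ ⟨v, hv, rfl⟩
      obtain ⟨u, hu, huv⟩ := h2 _ v.2 hv
      exact ⟨u, hu, huv⟩
    rw [(Submodule.equivMapOfInjective V.subtype V.injective_subtype (LinearMap.ker P)).finrank_eq]
    exact (Submodule.finrank_mono this).trans (Submodule.finrank_map_le S V'')
  omega

/-- restriction of a polynomial to a parametrized affine line -/
noncomputable def lpoly (a b : Fin N → k) : MvPolynomial (Fin N) k →ₐ[k] Polynomial k :=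
  aeval (fun i => Polynomial.C (a i) + Polynomial.X * Polynomial.C (b i))

lemma lpoly_eval (a b : Fin N → k) (F : MvPolynomial (Fin N) k) (x : k) :
    (lpoly a b F).eval x = eval (a + x • b) F := by
  induction F using MvPolynomial.induction_on with
  | C r => simp [lpoly]
  | add p q hp hq => simp [hp, hq]
  | mul_X p i hp => simp [hp]; left; simp [lpoly]; ring

lemma eval_smul_of_homog {d : ℕ} {F : MvPolynomial (Fin N) k} (hF : F.IsHomogeneous d)
    (s : k) (x : Fin N → k) : eval (s • x) F = s ^ d * eval x F := by
  rw [eval_eq, eval_eq, Finset.mul_sum]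
  refine Finset.sum_congr rfl fun m hm => ?_
  have hmd : ∑ i ∈ m.support, m i = d := by
    have := hF (mem_support_iff.1 hm)
    simpa [Finsupp.weight_apply, Finsupp.sum] using this
  simp only [Pi.smul_apply, smul_eq_mul, mul_pow, Finset.prod_mul_distrib]
  rw [Finset.prod_pow_eq_pow_sum, hmd]
  ring

lemma vl_of_affine [Infinite k] {d : ℕ} {F : MvPolynomial (Fin N) k} (hF : F.IsHomogeneous d)
    {a b : Fin N → k} (haff : ∀ x : k, eval (a + x • b) F = 0) : vl F a b := by
  have hne : ∀ s t : k, s ≠ 0 → eval (s • a + t • b) F = 0 := by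
    intro s t hs
    have : s • a + t • b = s • (a + (t / s) • b) := by
      rw [smul_add, smul_smul, mul_div_cancel₀ _ hs]
    rw [this, eval_smul_of_homog hF, haff, mul_zero]
  intro s t
  by_cases hs : s = 0
  · subst hs
    have : lpoly (t • b) a F = 0 := by
      apply Polynomial.eq_zero_of_infinite_isRoot
      refine Set.Infinite.mono (s := {0}ᶜ) ?_ (Set.Finite.infinite_compl (Set.finite_singleton 0))
      intro x hx
      change Polynomial.eval x _ = 0
      rw [lpoly_eval, add_comm]
      exact hne x t hx
    have h2 := lpoly_eval (t • b) a F 0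
    rw [this] at h2
    rw [add_comm, ← h2]
    simp
  · exact hne s t hs

/-- a form of degree `d` vanishing at `d+1` points of a line vanishes on it -/
lemma vl_of_points [CharZero k] {d : ℕ} {F : MvPolynomial (Fin N) k} (hF : F.IsHomogeneous d)
    {a b : Fin N → k} (h : ∀ i : Fin (d+1), eval (a + ((i : ℕ) : k) • b) F = 0) : vl F a b := by
  have hdeg : (lpoly a b F).natDegree ≤ d := by
    have h1 : (lpoly a b F).natDegree ≤ F.totalDegree * 1 := by
      apply MvPolynomial.aeval_natDegree_le
      · exact le_rfl
      · intro i
        compute_degree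
    have := hF.totalDegree_le
    omega
  have h0 : lpoly a b F = 0 := by
    by_contra hne
    have hinj : Function.Injective (fun i : Fin (d+1) => ((i : ℕ) : k)) := by
      intro i j hij
      have : ((i : ℕ) : k) = ((j : ℕ) : k) := hij
      exact Fin.ext (by exact_mod_cast this)
    have hc := Polynomial.card_le_degree_of_subset_roots (p := lpoly a b F)
      (Z := Finset.univ.map ⟨_, hinj⟩) (by
        intro x hx
        simp only [Finset.map_val, Finset.univ, Multiset.mem_map, Function.Embedding.coeFn_mk] at hx
        obtain ⟨i, _, rfl⟩ := hx
        rw [Polynomial.mem_roots hne, Polynomial.IsRoot, lpoly_eval]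
        exact h i)
    simp at hc
    omega
  apply vl_of_affine hF
  intro x
  rw [← lpoly_eval, h0]
  simp

end forms

section deform

variable {k : Type} [Field k] {N : ℕ}
variable {E : Type} [AddCommGroup E] [Module k E]

open Module in
lemma LOpen.rank_inf {M : Type} [AddCommGroup M] [Module k M] [FiniteDimensional k M]
    {Λ : Type} (V : Submodule k M) (Φ : E → Λ → (M →ₗ[k] k))
    (h : ∀ l v, PolyOn k (fun e => Φ e l v)) (b : ℕ) :
    LOpen k {e | finrank k ↥(V ⊓ ⨅ l, LinearMap.ker (Φ e l)) ≤ b} := by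
  have h1 := LOpen.rank (M := V) (fun e l => (Φ e l).comp V.subtype) (fun l v => h l v.1) b
  have hs : {e | finrank k ↥(V ⊓ ⨅ l, LinearMap.ker (Φ e l)) ≤ b} =
      {e | finrank k ↥(⨅ l, LinearMap.ker ((Φ e l).comp V.subtype)) ≤ b} := by
    ext e
    change finrank k _ ≤ b ↔ finrank k _ ≤ b
    have : V ⊓ ⨅ l, LinearMap.ker (Φ e l) =
        (⨅ l, LinearMap.ker ((Φ e l).comp V.subtype)).map V.subtype := by
      ext v
      simp only [Submodule.mem_inf, Submodule.mem_iInf, LinearMap.mem_ker, Submodule.mem_map]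
      constructor
      · rintro ⟨h1, h2⟩
        exact ⟨⟨v, h1⟩, h2, rfl⟩
      · rintro ⟨w, h2, rfl⟩
        exact ⟨w.2, h2⟩
    rw [this, ← (Submodule.equivMapOfInjective V.subtype V.injective_subtype _).finrank_eq]
  rw [hs]
  exact h1

lemma PolyOn.polyEval {f : E → k} (hf : PolyOn k f) (q : Polynomial k) :
    PolyOn k (fun e => q.eval (f e)) := by
  induction q using Polynomial.induction_on with
  | C a => simpa using PolyOn.const a
  | add p q hp hq => simpa using hp.add hq
  | monomial n a ih =>
    simp only [pow_succ, ← mul_assoc, Polynomial.eval_mul, Polynomial.eval_X] at ih ⊢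
    exact ih.mul hf

lemma lpoly_coeff_one (p c : Fin N → k) (F : MvPolynomial (Fin N) k) :
    (lpoly p c F).coeff 1 = dv p c F := by
  have h0 : ∀ G : MvPolynomial (Fin N) k, (lpoly p c G).coeff 0 = eval p G := by
    intro G
    rw [Polynomial.coeff_zero_eq_eval_zero, lpoly_eval]
    simp
  induction F using MvPolynomial.induction_on with
  | C r => simp [lpoly, dv_C]
  | add p q hp hq => simp [hp, hq]
  | mul_X q i hq =>
    rw [map_mul, Polynomial.mul_coeff_one, dv_mul, dv_X, hq, h0, h0]
    have : (lpoly p c (X i)).coeff 1 = c i := by simp [lpoly, Polynomial.coeff_C]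
    rw [this]
    ring

lemma lpoly_coeff_zero (p c : Fin N → k) (G : MvPolynomial (Fin N) k) :
    (lpoly p c G).coeff 0 = eval p G := by
  rw [Polynomial.coeff_zero_eq_eval_zero, lpoly_eval]
  simp

/-- difference quotient functional -/
noncomputable def dq (p c : Fin N → k) (ε : k) : MvPolynomial (Fin N) k →ₗ[k] k where
  toFun F := (Polynomial.divX (lpoly p c F)).eval ε
  map_add' F G := by simp [Polynomial.divX_add]
  map_smul' r F := by
    rw [map_smul, Polynomial.smul_eq_C_mul, Polynomial.divX_C_mul]
    simp

lemma dq_zero (p c : Fin N → k) (F : MvPolynomial (Fin N) k) : dq p c 0 F = dv p c F := by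
  change (Polynomial.divX (lpoly p c F)).eval 0 = _
  rw [← Polynomial.coeff_zero_eq_eval_zero, Polynomial.coeff_divX, lpoly_coeff_one]

lemma dq_mul (p c : Fin N → k) (ε : k) (F : MvPolynomial (Fin N) k) :
    ε * dq p c ε F + eval p F = eval (p + ε • c) F := by
  rw [← lpoly_eval, ← lpoly_coeff_zero p c]
  have := congrArg (Polynomial.eval ε) (Polynomial.X_mul_divX_add (lpoly p c F))
  rw [← this]
  simp only [Polynomial.eval_add, Polynomial.eval_mul, Polynomial.eval_X, Polynomial.eval_C]
  rfl

open Module in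
lemma Good.deform [Infinite k] {d b : ℕ} {ι κ : Type} (h : Good k N d (ι ⊕ Unit) κ b) :
    Good k N d ι (κ ⊕ Fin 2) b := by
  obtain ⟨S, L, h⟩ := h
  set p := S 0 (Sum.inr ()) with hp
  set a := S 1 (Sum.inr ()) with ha
  set c' := S 2 (Sum.inr ()) with hb
  set c := S 3 (Sum.inr ()) with hc
  let V : Submodule k (Rf k N d) := KS d (fun j i => S j (Sum.inl i))
    ![Sum.elim (L 0) (fun _ : Unit => p), Sum.elim (L 1) (fun _ : Unit => a)]
  let Φ : k → (k × k ⊕ Unit) → (Rf k N d →ₗ[k] k) := fun ε l =>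
    (Sum.elim (fun j => evL (j.1 • (p + ε • c) + j.2 • c'))
      (fun _ => dq p c ε) l).comp (Submodule.subtype _)
  have hV : ∀ ε F, F ∈ V ⊓ ⨅ l, LinearMap.ker (Φ ε l) ↔
      F ∈ V ∧ vl F.1 (p + ε • c) c' ∧ dq p c ε F.1 = 0 := by
    intro ε F
    simp [Φ, iInf_sum, iInf_prod, vl, evL]
  have hΦ : ∀ l v, PolyOn k (fun e => Φ e l v) := by
    have hid : PolyOn k (fun e : k => e) := PolyOn.lin (LinearMap.id : k →ₗ[k] k)
    rintro (⟨s, t⟩ | _) F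
    · change PolyOn k fun e : k => eval (fun i => s * (p i + e * c i) + t * c' i) F.1
      exact PolyOn.evalMv (fun i => ((PolyOn.const s).mul ((PolyOn.const _).add
        (hid.mul (PolyOn.const _)))).add (PolyOn.const _)) _
    · exact hid.polyEval _
  have h0 : (0 : k) ∈ {e | finrank k ↥(V ⊓ ⨅ l, LinearMap.ker (Φ e l)) ≤ b} := by
    refine le_trans (Submodule.finrank_mono ?_) h
    intro F hF
    rw [hV, mem_KS] at hF
    obtain ⟨⟨h1, h2, h3, h4⟩, h5, h6⟩ := hF
    rw [dq_zero] at h6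
    rw [mem_KS]
    refine ⟨?_, ?_, ?_, ?_⟩
    · rintro (i | i)
      · exact h1 i
      · exact h3 (Sum.inr ())
    · rintro (i | i)
      · exact h2 i
      · simpa using h5
    · intro j
      exact h3 (Sum.inl j)
    · rintro (i | i)
      · exact h4 i
      · exact h6
  have hfin := LOpen.rank_inf V Φ hΦ b 0 1 h0
  obtain ⟨ε, hε⟩ := (hfin.union (Set.finite_singleton 0)).exists_notMem
  simp only [Set.mem_union, not_or, Set.mem_singleton_iff, Set.mem_ofPred_eq, not_not, zero_add,
    smul_eq_mul, mul_one] at hε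
  refine ⟨fun j i => S j (Sum.inl i),
    ![Sum.elim (L 0) ![p, p + ε • c], Sum.elim (L 1) ![a, c']],
    le_trans (Submodule.finrank_mono ?_) hε.1⟩
  intro F hF
  rw [mem_KS] at hF
  obtain ⟨h1, h2, h3, h4⟩ := hF
  have e1 : vl F.1 p a := h3 (Sum.inr 0)
  have e2 : vl F.1 (p + ε • c) c' := h3 (Sum.inr 1)
  rw [hV, mem_KS]
  refine ⟨⟨h1, h2, ?_, h4⟩, e2, ?_⟩
  · rintro (j | j)
    · exact h3 (Sum.inl j)
    · exact e1
  · have := dq_mul p c ε F.1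
    rw [e1.left, e2.left] at this
    simpa [hε.2] using this

lemma GoodN.deform [Infinite k] {d b m l : ℕ} (h : GoodN k N d (m+1) l b) :
    GoodN k N d m (l+2) b :=
  Good.toN (Good.deform (h.toT (Fin m ⊕ Unit) (Fin l) (by simp) (by simp))) (by simp) (by simp)
    le_rfl

lemma GoodN.deform_many [Infinite k] {d b m l : ℕ} (j : ℕ) (h : GoodN k N d (m+j) l b) :
    GoodN k N d m (l+2*j) b := by
  induction j generalizing m l with
  | zero => simpa using h
  | succ j ih =>
    have h1 : GoodN k N d (m+1) (l+2*j) b := ih (by convert h using 1; omega)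
    exact h1.deform

open Module in
/-- dropping lines -/
lemma Good.drop [CharZero k] {d b : ℕ} {ι κ κ' : Type} [Fintype κ']
    (h : Good k N d ι (κ ⊕ κ') b) : Good k N d ι κ (b + Fintype.card κ' * (d+1)) := by
  obtain ⟨S, L, h⟩ := h
  refine ⟨S, fun j i => L j (Sum.inl i), ?_⟩
  have := finrank_drop (M := Rf k N d) (α := κ' × Fin (d+1))
    (fun a => (evL (L 0 (Sum.inr a.1) + ((a.2 : ℕ) : k) • L 1 (Sum.inr a.1))).comp
      (Submodule.subtype _)) (KS d S (fun j i => L j (Sum.inl i))) (KS d S L) (by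
      intro F hF hz
      rw [mem_KS] at hF ⊢
      refine ⟨hF.1, hF.2.1, ?_, hF.2.2.2⟩
      rintro (j | j)
      · exact hF.2.2.1 j
      · exact vl_of_points F.2 fun i => hz (j, i))
  simp only [Fintype.card_prod, Fintype.card_fin] at this
  omega

lemma GoodN.drop [CharZero k] {d b m l : ℕ} (j : ℕ) (h : GoodN k N d m (l+j) b) :
    GoodN k N d m l (b + j*(d+1)) := by
  have := Good.drop (h.toT (Fin m) (Fin l ⊕ Fin j) (by simp) (by simp))
  exact this.toN (by simp) (by simp) (by simp)

/-- lines only can be completed to sundials and lines -/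
lemma Good.extend {d b : ℕ} {ι κ : Type} (h : Good k N d Empty (ι ⊕ κ) b) :
    Good k N d ι κ b := by
  obtain ⟨S, L, h⟩ := h
  refine ⟨![fun i => L 0 (Sum.inl i), fun i => L 1 (Sum.inl i), 0, 0],
    fun j i => L j (Sum.inr i), le_trans (Submodule.finrank_mono ?_) h⟩
  intro F hF
  rw [mem_KS] at hF ⊢
  refine ⟨fun i => i.elim, fun i => i.elim, ?_, fun i => i.elim⟩
  rintro (i | i)
  · exact hF.1 i
  · exact hF.2.2.1 i

lemma GoodN.more {d b m l l' : ℕ} (h : GoodN k N d m l b) (hl : l ≤ l') :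
    GoodN k N d m l' b := by
  obtain ⟨S, L, h⟩ := h
  refine ⟨S, fun j i => if hi : i.1 < l then L j ⟨i.1, hi⟩ else 0,
    le_trans (Submodule.finrank_mono ?_) h⟩
  intro F hF
  rw [mem_KS] at hF ⊢
  refine ⟨hF.1, hF.2.1, fun j => ?_, hF.2.2.2⟩
  have := hF.2.2.1 ⟨j.1, by omega⟩
  simpa using this

lemma GoodN.extend {d m l r : ℕ} (h : GoodN k N d 0 r 0) (hr : r ≤ m + l) :
    GoodN k N d m l 0 :=
  Good.extend ((h.more hr).toT Empty (Fin m ⊕ Fin l) (by simp) (by simp))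

lemma GoodN.mono {d m l b b' : ℕ} (h : GoodN k N d m l b) (hb : b ≤ b') :
    GoodN k N d m l b' := Good.equiv h (Equiv.refl _) (Equiv.refl _) hb

end deform

section hyper

variable {k : Type} [Field k] {N n : ℕ}

open Module in
lemma finrank_Rf (d : ℕ) : finrank k (Rf k (n+1) d) = (d+n).choose n := by
  have e1 : Rf k (n+1) d ≃ₗ[k] ({m : Fin (n+1) →₀ ℕ | m.degree = d} →₀ k) :=
    (LinearEquiv.ofEq _ _ (homogeneousSubmodule_eq_finsupp_supported (Fin (n+1)) k d)).trans
      (AddMonoidAlgebra.supportedEquivFinsupp _)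
  let e2 : {m : Fin (n+1) →₀ ℕ | m.degree = d} ≃ Sym (Fin (n+1)) d :=
    (Equiv.subtypeEquivRight (fun m => by
      change (∑ i ∈ m.support, m i = d) ↔ _
      simp [Finsupp.sum])).trans (Sym.equivNatSum (Fin (n+1)) d).symm
  have : Finite {m : Fin (n+1) →₀ ℕ | m.degree = d} := Finite.of_equiv _ e2.symm
  have : Fintype {m : Fin (n+1) →₀ ℕ | m.degree = d} := Fintype.ofFinite _
  rw [e1.finrank_eq, finrank_finsupp_self, Fintype.card_congr e2, Sym.card_sym_eq_choose]
  simp only [Fintype.card_fin]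
  have : n + 1 + d - 1 = d + n := by omega
  rw [this]
  exact (Nat.choose_symm_add (a := d) (b := n))

lemma homog_quot {e d : ℕ} {F Q G : MvPolynomial (Fin N) k} (hF : F.IsHomogeneous (e+d))
    (hQ : Q.IsHomogeneous e) (h : F = Q * G) :
    ∃ G' : Rf k N d, F = Q * G'.1 := by
  let _ := MvPolynomial.gradedAlgebra (σ := Fin N) (R := k)
  have := DirectSum.coe_decompose_mul_add_of_left_mem (homogeneousSubmodule (Fin N) k)
    (i := e) (j := d) (a := Q) (b := G) hQ
  refine ⟨DirectSum.decompose (homogeneousSubmodule (Fin N) k) G d, ?_⟩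
  rw [← this, ← h, DirectSum.decompose_of_mem_same _ hF]

/-- restriction to the hyperplane `x₀ = 0` -/
noncomputable def rho : MvPolynomial (Fin (n+1)) k →ₐ[k] MvPolynomial (Fin n) k :=
  aeval (Fin.cons 0 X : Fin (n+1) → MvPolynomial (Fin n) k)

lemma rho_X0 : rho (X 0 : MvPolynomial (Fin (n+1)) k) = 0 := by simp [rho]

lemma rho_Xs (i : Fin n) : rho (X i.succ : MvPolynomial (Fin (n+1)) k) = X i := by simp [rho]

/-- embedding of the hyperplane -/
def c0 (v : Fin n → k) : Fin (n+1) → k := Fin.cons 0 v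

lemma c0_zero (v : Fin n → k) : c0 v 0 = 0 := rfl
lemma c0_succ (v : Fin n → k) (i : Fin n) : c0 v i.succ = v i := rfl

lemma c0_lin (s t : k) (v w : Fin n → k) : c0 (s • v + t • w) = s • c0 v + t • c0 w := by
  ext i
  refine Fin.cases ?_ (fun j => ?_) i
  · simp [c0_zero]
  · simp [c0_succ]

lemma rho_eval (F : MvPolynomial (Fin (n+1)) k) (v : Fin n → k) :
    eval v (rho F) = eval (c0 v) F := by
  induction F using MvPolynomial.induction_on with
  | C r => simp [rho]
  | add p q hp hq => simp [hp, hq]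
  | mul_X p i hp =>
    rw [map_mul, map_mul, map_mul, hp]
    congr 1
    refine Fin.cases ?_ (fun j => ?_) i
    · simp [rho_X0, c0_zero]
    · simp [rho_Xs, c0_succ]

lemma rho_dv (F : MvPolynomial (Fin (n+1)) k) (p c : Fin n → k) :
    dv p c (rho F) = dv (c0 p) (c0 c) F := by
  induction F using MvPolynomial.induction_on with
  | C r => simp [rho, dv_C]
  | add p q hp hq => simp [hp, hq]
  | mul_X q i hq =>
    rw [map_mul, dv_mul, dv_mul, hq, rho_eval, rho_eval]
    congr 2
    refine Fin.cases ?_ (fun j => ?_) i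
    · simp [rho_X0, c0_zero, dv_X]
    · simp [rho_Xs, c0_succ, dv_X]

lemma rho_vl {F : MvPolynomial (Fin (n+1)) k} {a b : Fin n → k} :
    vl (rho F) a b ↔ vl F (c0 a) (c0 b) := by
  simp only [vl, rho_eval, c0_lin]

lemma rho_homog {d : ℕ} {F : MvPolynomial (Fin (n+1)) k} (hF : F.IsHomogeneous d) :
    (rho F).IsHomogeneous d := by
  have := hF.aeval (S := k) (n := 1) (Fin.cons 0 X : Fin (n+1) → MvPolynomial (Fin n) k) (by
    intro i
    refine Fin.cases ?_ (fun j => ?_) i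
    · simpa using isHomogeneous_zero _ _ _
    · simpa using isHomogeneous_X _ _)
  rw [one_mul] at this
  exact this

/-- restriction on forms -/
noncomputable def rhoL (d : ℕ) : Rf k (n+1) d →ₗ[k] Rf k n d where
  toFun F := ⟨rho F.1, rho_homog F.2⟩
  map_add' F G := by ext1; simp
  map_smul' r F := by ext1; simp

lemma rho_sub (F : MvPolynomial (Fin (n+1)) k) :
    ∃ G, F - rename Fin.succ (rho F) = X 0 * G := by
  induction F using MvPolynomial.induction_on with
  | C r => exact ⟨0, by simp [rho]⟩
  | add p q hp hq =>
    obtain ⟨G, hG⟩ := hp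
    obtain ⟨G', hG'⟩ := hq
    refine ⟨G + G', ?_⟩
    rw [mul_add, ← hG, ← hG', map_add, map_add]
    ring
  | mul_X p i hp =>
    obtain ⟨G, hG⟩ := hp
    rw [map_mul, map_mul]
    refine Fin.cases ?_ (fun j => ?_) i
    · exact ⟨p, by rw [rho_X0]; simp; ring⟩
    · refine ⟨G * X j.succ, ?_⟩
      rw [rho_Xs, rename_X, ← mul_assoc, ← hG]
      ring

lemma X0_dvd_of_rho {d : ℕ} (F : Rf k (n+1) (1+d)) (h : rho F.1 = 0) :
    ∃ G : Rf k (n+1) d, F.1 = X 0 * G.1 := by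
  obtain ⟨G, hG⟩ := rho_sub F.1
  rw [h, map_zero, sub_zero] at hG
  exact homog_quot F.2 (isHomogeneous_X _ _) hG

/-- multiplication by `x₀` -/
noncomputable def mulX0 (d : ℕ) : Rf k (n+1) d →ₗ[k] Rf k (n+1) (d+1) where
  toFun F := ⟨X 0 * F.1, by
    have := (isHomogeneous_X k (0 : Fin (n+1))).mul F.2
    rwa [add_comm 1 d] at this⟩
  map_add' F G := by ext1; simp [mul_add]
  map_smul' r F := by ext1; simp

lemma vl_of_mul [Infinite k] {d : ℕ} {Q : MvPolynomial (Fin N) k} {G : MvPolynomial (Fin N) k}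
    (hG : G.IsHomogeneous d)
    {a b : Fin N → k} (h : vl (Q * G) a b) (hx : ∃ s t : k, eval (s • a + t • b) Q ≠ 0) :
    vl G a b := by
  obtain ⟨s, t, hst⟩ := hx
  intro s' t'
  have h1 : lpoly (s • a + t • b) (s' • a + t' • b) (Q * G) = 0 := by
    apply Polynomial.funext
    intro x
    rw [lpoly_eval]
    have := h (s + x * s') (t + x * t')
    rw [Polynomial.eval_zero, ← this]
    congr 2
    module
  have h1' : lpoly (s' • a + t' • b) (s • a + t • b) (Q * G) = 0 := by
    apply Polynomial.funext
    intro x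
    rw [lpoly_eval]
    have := h (s' + x * s) (t' + x * t)
    rw [Polynomial.eval_zero, ← this]
    congr 2
    module
  rw [map_mul, mul_eq_zero] at h1 h1'
  have hQ : lpoly (s • a + t • b) (s' • a + t' • b) Q ≠ 0 := by
    intro h0
    apply hst
    have := lpoly_eval (s • a + t • b) (s' • a + t' • b) Q 0
    rw [h0] at this
    simpa using this.symm
  have hG0 := h1.resolve_left hQ
  have : vl G (s • a + t • b) (s' • a + t' • b) := by
    apply vl_of_affine hG
    intro x
    rw [← lpoly_eval, hG0]
    simp
  exact this.right

lemma vl_of_mul_X0 [Infinite k] {d : ℕ} {G : MvPolynomial (Fin (n+1)) k} (hG : G.IsHomogeneous d)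
    {a b : Fin (n+1) → k} (h : vl (X 0 * G) a b) (hx : a 0 ≠ 0 ∨ b 0 ≠ 0) : vl G a b := by
  apply vl_of_mul hG h
  rcases hx with hx | hx
  · exact ⟨1, 0, by simpa using hx⟩
  · exact ⟨0, 1, by simpa using hx⟩

lemma KS_residual [Infinite k] {d : ℕ} {ι κ : Type} {S : Fin 4 → ι → Fin (n+1) → k}
    {L : Fin 2 → κ → Fin (n+1) → k} {G : Rf k (n+1) d}
    (hS : ∀ i, S 0 i 0 ≠ 0) (hL : ∀ j, L 1 j 0 ≠ 0) (h : mulX0 d G ∈ KS (d+1) S L) :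
    G ∈ KS d S L := by
  rw [mem_KS] at h ⊢
  obtain ⟨h1, h2, h3, h4⟩ := h
  have e1 : ∀ i, vl G.1 (S 0 i) (S 1 i) := fun i => vl_of_mul_X0 G.2 (h1 i) (Or.inl (hS i))
  refine ⟨e1, fun i => vl_of_mul_X0 G.2 (h2 i) (Or.inl (hS i)),
    fun i => vl_of_mul_X0 G.2 (h3 i) (Or.inr (hL i)), fun i => ?_⟩
  have := h4 i
  change dv _ _ (X 0 * G.1) = 0 at this
  rw [dv_mul, (e1 i).left, mul_zero, zero_add, eval_X] at this
  exact (mul_eq_zero.1 this).resolve_left (hS i)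

lemma eq_zero_of_eval [Infinite k] {d : ℕ} (F : Rf k N d) (h : ∀ v, eval v F.1 = 0) : F = 0 := by
  ext1
  apply MvPolynomial.funext
  intro v
  simpa using h v

open Module in
lemma good_one [CharZero k] (r : ℕ) : GoodN k (n+1) 1 0 r ((1+n).choose n - r*(1+1)) := by
  obtain ⟨w, hw⟩ := exists_points (M := Rf k (n+1) 1) (Ω := Fin (n+1) → k)
    (fun v => (evL v).comp (Submodule.subtype _)) ⊤
    (fun F _ h => eq_zero_of_eval F h) (Fin r × Fin 2)
  refine ⟨fun _ => Fin.elim0, fun j i => w (i, j), le_trans (Submodule.finrank_mono ?_)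
    (hw.trans ?_)⟩
  · intro F hF
    rw [mem_KS] at hF
    simp only [top_inf_eq, Submodule.mem_iInf, LinearMap.mem_ker]
    rintro ⟨i, j⟩
    have h1 : eval (w (i, 0)) F.1 = 0 := (hF.2.2.1 i).left
    have h2 : eval (w (i, 1)) F.1 = 0 := (hF.2.2.1 i).right
    fin_cases j
    · exact h1
    · exact h2
  · rw [finrank_top, finrank_Rf]
    simp

open Module in
lemma good_zero [CharZero k] (r : ℕ) : GoodN k (n+1) 0 0 r ((0+n).choose n - r*(0+1)) := by
  obtain ⟨w, hw⟩ := exists_points (M := Rf k (n+1) 0) (Ω := Fin (n+1) → k)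
    (fun v => (evL v).comp (Submodule.subtype _)) ⊤
    (fun F _ h => eq_zero_of_eval F h) (Fin r)
  refine ⟨fun _ => Fin.elim0, fun j i => w i, le_trans (Submodule.finrank_mono ?_)
    (hw.trans ?_)⟩
  · intro F hF
    rw [mem_KS] at hF
    simp only [top_inf_eq, Submodule.mem_iInf, LinearMap.mem_ker]
    exact fun i => (hF.2.2.1 i).left
  · rw [finrank_top, finrank_Rf]
    simp

end hyper

section mainstep

variable {k : Type} [Field k] {N n : ℕ}

lemma exists_mulX0 {d : ℕ} (F : Rf k (n+1) (d+1)) (h : rho F.1 = 0) :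
    ∃ G : Rf k (n+1) d, mulX0 d G = F := by
  have hF : F.1.IsHomogeneous (1+d) := by
    rw [add_comm 1 d]
    exact F.2
  obtain ⟨G, hG⟩ := X0_dvd_of_rho ⟨F.1, hF⟩ h
  exact ⟨G, Subtype.ext hG.symm⟩

/-- projection to the hyperplane -/
def tl (v : Fin (n+1) → k) : Fin n → k := fun i => v i.succ

lemma tl_c0 (v : Fin n → k) : tl (c0 v) = v := rfl

lemma c0_tl {v : Fin (n+1) → k} (h : v 0 = 0) : c0 (tl v) = v := by
  ext i
  refine Fin.cases ?_ (fun j => ?_) i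
  · rw [h]; rfl
  · rfl

/-- sundials with line directions projected to the hyperplane -/
def prS {ι : Type} (S : Fin 4 → ι → Fin (n+1) → k) : Fin 4 → ι → Fin (n+1) → k :=
  ![S 0, fun i => c0 (tl (S 1 i)), fun i => c0 (tl (S 2 i)), S 3]

/-- lines with one point projected to the hyperplane -/
def prL {κ : Type} (L : Fin 2 → κ → Fin (n+1) → k) : Fin 2 → κ → Fin (n+1) → k :=
  ![fun i => c0 (tl (L 0 i)), L 1]

/-- parameters -/
abbrev PSp (k : Type) (n : ℕ) (ι κ ι' κ' : Type) : Type :=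
  ((Fin 4 → ι → Fin (n+1) → k) × (Fin 2 → κ → Fin (n+1) → k)) ×
  ((Fin 4 → ι' → Fin n → k) × (Fin 2 → κ' → Fin n → k))

/-- residual system -/
def Kres (d : ℕ) {ι κ ιc : Type} (S : Fin 4 → ι → Fin (n+1) → k)
    (L : Fin 2 → κ → Fin (n+1) → k) (w : ιc → Fin n → k) : Submodule k (Rf k (n+1) d) :=
  K d (Sum.elim (S 0) (Sum.elim (S 0) (prL L 0)))
    (Sum.elim (prS S 1) (Sum.elim (prS S 2) (L 1))) (S 0) (S 3) (fun i => c0 (w i))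

lemma mem_Kres {d : ℕ} {ι κ ιc : Type} {S : Fin 4 → ι → Fin (n+1) → k}
    {L : Fin 2 → κ → Fin (n+1) → k} {w : ιc → Fin n → k} {F : Rf k (n+1) d} :
    F ∈ Kres d S L w ↔ F ∈ KS d (prS S) (prL L) ∧ ∀ i, eval (c0 (w i)) F.1 = 0 := by
  simp [Kres, mem_KS, mem_K, and_assoc, prS, prL]

/-- trace system -/
def Ktr (d : ℕ) {ιc ιs κ' α : Type} (S : Fin 4 → (ιc ⊕ ιs) → Fin N → k)
    (L : Fin 2 → κ' → Fin N → k) (w : α → Fin N → k) : Submodule k (Rf k N d) :=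
  K d (Sum.elim (S 0) (Sum.elim (S 0) (L 0))) (Sum.elim (S 1) (Sum.elim (S 2) (L 1)))
    (fun i : ιs => S 0 (Sum.inr i)) (fun i => S 3 (Sum.inr i)) w

lemma mem_Ktr {d : ℕ} {ιc ιs κ' α : Type} {S : Fin 4 → (ιc ⊕ ιs) → Fin N → k}
    {L : Fin 2 → κ' → Fin N → k} {w : α → Fin N → k} {F : Rf k N d} :
    F ∈ Ktr d S L w ↔ (∀ i, vl F.1 (S 0 i) (S 1 i)) ∧ (∀ i, vl F.1 (S 0 i) (S 2 i)) ∧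
    (∀ j, vl F.1 (L 0 j) (L 1 j)) ∧ (∀ i, dv (S 0 (Sum.inr i)) (S 3 (Sum.inr i)) F.1 = 0) ∧
    ∀ a, eval (w a) F.1 = 0 := by
  simp [Ktr, mem_K, and_assoc]

lemma proj_aux {E α β : Type} [AddCommGroup E] [Module k E] {m : ℕ} (T : E →ₗ[k] (α → β → Fin m → k))
    (a : α) (i : β) (x : Fin m) : PolyOn k fun e => T e a i x :=
  PolyOn.lin ((LinearMap.proj x).comp ((LinearMap.proj i).comp ((LinearMap.proj a).comp T)))

variable [CharZero k]

open Module in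
lemma res_nonempty {e : ℕ} {ι1 κ1 ιc : Type} [Finite ι1] [Finite κ1] [Fintype ιc]
    (hA : Good k (n+1) (e+1) ι1 κ1 (Fintype.card ιc)) (hB : Good k (n+1) e ι1 κ1 0) :
    ∃ (S : Fin 4 → ι1 → Fin (n+1) → k) (L : Fin 2 → κ1 → Fin (n+1) → k) (w : ιc → Fin n → k),
      finrank k (Kres (e+1) S L w) ≤ 0 := by
  let E := (Fin 4 → ι1 → Fin (n+1) → k) × (Fin 2 → κ1 → Fin (n+1) → k)
  obtain ⟨SA, LA, hA⟩ := hA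
  obtain ⟨SB, LB, hB⟩ := hB
  let P3 : Set E := ⋂ i : ι1, {x | x.1 0 i 0 ≠ 0}
  let P4 : Set E := ⋂ i : κ1, {x | x.2 1 i 0 ≠ 0}
  have h3 : LOpen k P3 := LOpen.iInter fun i =>
    LOpen.ne_zero (proj_aux (E := E) (LinearMap.fst k (Fin 4 → ι1 → Fin (n+1) → k)
      (Fin 2 → κ1 → Fin (n+1) → k)) 0 i 0)
  have h4 : LOpen k P4 := LOpen.iInter fun i =>
    LOpen.ne_zero (proj_aux (E := E) (LinearMap.snd k (Fin 4 → ι1 → Fin (n+1) → k)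
      (Fin 2 → κ1 → Fin (n+1) → k)) 1 i 0)
  have h34 : (P3 ∩ P4).Nonempty := by
    refine ⟨(1, 1), ?_, ?_⟩
    · simp [P3]
    · simp [P4]
  obtain ⟨x, hx1, hx2, hx3, hx4⟩ := (LOpen_KS (k := k) (N := n+1) (e+1) ι1 κ1
      (Fintype.card ιc)).nonempty_inter
    ((LOpen_KS (k := k) (N := n+1) e ι1 κ1 0).inter (h3.inter h4)) ⟨(SA, LA), hA⟩
    ((LOpen_KS (k := k) (N := n+1) e ι1 κ1 0).nonempty_inter (h3.inter h4) ⟨(SB, LB), hB⟩ h34)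
  obtain ⟨S, L⟩ := x
  change finrank k (KS (e+1) S L) ≤ _ at hx1
  change finrank k (KS e S L) ≤ _ at hx2
  have hS : ∀ i, S 0 i 0 ≠ 0 := fun i => Set.mem_iInter.1 hx3 i
  have hL : ∀ i, L 1 i 0 ≠ 0 := fun i => Set.mem_iInter.1 hx4 i
  let S' : Fin 4 → ι1 → Fin (n+1) → k := ![S 0, fun i => S 1 i - (S 1 i 0 / S 0 i 0) • S 0 i,
    fun i => S 2 i - (S 2 i 0 / S 0 i 0) • S 0 i, S 3]
  let L' : Fin 2 → κ1 → Fin (n+1) → k := ![fun i => L 0 i - (L 0 i 0 / L 1 i 0) • L 1 i, L 1]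
  have hS'0 : prS S' = S' := by
    have e1 : ∀ i, S' 1 i 0 = 0 := fun i => by simp [S', hS i]
    have e2 : ∀ i, S' 2 i 0 = 0 := fun i => by simp [S', hS i]
    funext j
    fin_cases j
    · rfl
    · funext i; exact c0_tl (e1 i)
    · funext i; exact c0_tl (e2 i)
    · rfl
  have hL'0 : prL L' = L' := by
    have e1 : ∀ i, L' 0 i 0 = 0 := fun i => by simp [L', hL i]
    funext j
    fin_cases j
    · funext i; exact c0_tl (e1 i)
    · rfl
  have hsub : ∀ d, KS d S' L' ≤ KS d S L := by
    intro d F hF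
    rw [mem_KS] at hF ⊢
    obtain ⟨f1, f2, f3, f4⟩ := hF
    refine ⟨fun i => (f1 i).span (x := 1) (y := 0) (z := S 1 i 0 / S 0 i 0) (w := 1) ?_ ?_,
      fun i => (f2 i).span (x := 1) (y := 0) (z := S 2 i 0 / S 0 i 0) (w := 1) ?_ ?_,
      fun i => (f3 i).span (x := 1) (y := L 0 i 0 / L 1 i 0) (z := 0) (w := 1) ?_ ?_, f4⟩
    all_goals simp [S', L']
  have hb : KS e S' L' = ⊥ := by
    have := (Submodule.finrank_mono (hsub e)).trans hx2
    exact Submodule.finrank_eq_zero.1 (by omega)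
  obtain ⟨w, hw⟩ := exists_points (M := Rf k (n+1) (e+1)) (Ω := Fin n → k)
    (fun v => (evL (c0 v)).comp (Submodule.subtype _)) (KS (e+1) S' L') (by
      intro F hF hz
      have h0 : rho F.1 = 0 := by
        apply MvPolynomial.funext
        intro v
        rw [rho_eval, map_zero]
        exact hz v
      obtain ⟨G, rfl⟩ := exists_mulX0 F h0
      have hG := KS_residual (S := S') (L := L') (fun i => hS i) (fun i => hL i) hF
      rw [hb, Submodule.mem_bot] at hG
      rw [hG, map_zero]) ιc
  refine ⟨S', L', w, le_trans (Submodule.finrank_mono ?_) (hw.trans ?_)⟩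
  · intro F hF
    rw [mem_Kres, hS'0, hL'0] at hF
    simp only [Submodule.mem_inf, Submodule.mem_iInf, LinearMap.mem_ker]
    exact hF
  · have := (Submodule.finrank_mono (hsub (e+1))).trans hx1
    omega

open Module in
lemma tr_nonempty {d c : ℕ} {ιc ιs κ2 α : Type} [Fintype ιc] [Fintype α]
    (hC : Good k N d (ιc ⊕ ιs) κ2 c) :
    ∃ (S : Fin 4 → (ιc ⊕ ιs) → Fin N → k) (L : Fin 2 → κ2 → Fin N → k) (w : α → Fin N → k),
      finrank k (Ktr d S L w) ≤ c + Fintype.card ιc - Fintype.card α := by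
  obtain ⟨S, L, hC⟩ := hC
  let V := Ktr d S L (Empty.elim : Empty → Fin N → k)
  obtain ⟨w, hw⟩ := exists_points (M := Rf k N d) (Ω := Fin N → k)
    (fun v => (evL v).comp (Submodule.subtype _)) V (fun F _ h => eq_zero_of_eval F h) α
  refine ⟨S, L, w, le_trans (Submodule.finrank_mono ?_) (hw.trans (Nat.sub_le_sub_right ?_ _))⟩
  · intro F hF
    rw [mem_Ktr] at hF
    simp only [Submodule.mem_inf, Submodule.mem_iInf, LinearMap.mem_ker]
    refine ⟨mem_Ktr.2 ⟨hF.1, hF.2.1, hF.2.2.1, hF.2.2.2.1, fun a => a.elim⟩, hF.2.2.2.2⟩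
  · refine (finrank_drop (fun i : ιc => (dv (S 0 (Sum.inl i)) (S 3 (Sum.inl i))).comp
      (Submodule.subtype _)) V (KS d S L) ?_).trans (Nat.add_le_add_right hC _)
    intro F hF hz
    rw [mem_Ktr] at hF
    rw [mem_KS]
    refine ⟨hF.1, hF.2.1, hF.2.2.1, ?_⟩
    rintro (i | i)
    · exact hz i
    · exact hF.2.2.2.1 i

open Module in
lemma horace_step {e c : ℕ} {ι1 κ1 ιc ιs κ2 : Type} [Fintype ι1] [Fintype κ1] [Fintype ιc]
    (hA : Good k (n+1) (e+1) ι1 κ1 (Fintype.card ιc)) (hB : Good k (n+1) e ι1 κ1 0)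
    (hC : Good k n (e+2) (ιc ⊕ ιs) κ2 c) :
    Good k (n+1) (e+2) (ι1 ⊕ (ιc ⊕ ιs)) (κ1 ⊕ κ2)
      (c + Fintype.card ιc - (2 * Fintype.card ι1 + Fintype.card κ1)) := by
  set bd := c + Fintype.card ιc - (2 * Fintype.card ι1 + Fintype.card κ1) with hbd
  let E := PSp k n ι1 κ1 (ιc ⊕ ιs) κ2
  let pt : E → ι1 ⊕ ι1 ⊕ κ1 → Fin n → k := fun x =>
    Sum.elim (fun i => tl (x.1.1 1 i)) (Sum.elim (fun i => tl (x.1.1 2 i)) (fun j => tl (x.1.2 0 j)))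
  let P1 : Set E := {x | finrank k (Kres (e+1) x.1.1 x.1.2 (fun i : ιc => x.2.1 0 (Sum.inl i))) ≤ 0}
  let P2 : Set E := {x | finrank k (Ktr (e+2) x.2.1 x.2.2 (pt x)) ≤ bd}
  let P3 : Set E := ⋂ i : ι1, {x | x.1.1 0 i 0 ≠ 0}
  let P4 : Set E := ⋂ i : κ1, {x | x.1.2 1 i 0 ≠ 0}
  have q1 : ∀ a i x, PolyOn k fun e : E => e.1.1 a i x := fun a i x =>
    proj_aux (E := E) ((LinearMap.fst k _ _).comp (LinearMap.fst k _ _)) a i x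
  have q2 : ∀ a i x, PolyOn k fun e : E => e.1.2 a i x := fun a i x =>
    proj_aux (E := E) ((LinearMap.snd k _ _).comp (LinearMap.fst k _ _)) a i x
  have q3 : ∀ a i x, PolyOn k fun e : E => e.2.1 a i x := fun a i x =>
    proj_aux (E := E) ((LinearMap.fst k _ _).comp (LinearMap.snd k _ _)) a i x
  have q4 : ∀ a i x, PolyOn k fun e : E => e.2.2 a i x := fun a i x =>
    proj_aux (E := E) ((LinearMap.snd k _ _).comp (LinearMap.snd k _ _)) a i x
  have qc : ∀ f : E → Fin n → k, (∀ x, PolyOn k fun e => f e x) →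
      ∀ x, PolyOn k fun e => c0 (f e) x := by
    intro f hf x
    refine Fin.cases ?_ (fun j => ?_) x
    · exact PolyOn.const 0
    · exact hf j
  have o1 : LOpen k P1 := by
    apply LOpen_K
    · rintro (i | i | i) x
      exacts [q1 _ _ _, q1 _ _ _, qc (fun e => tl (e.1.2 0 i)) (fun x => q2 _ _ _) x]
    · rintro (i | i | i) x
      exacts [qc (fun e => tl (e.1.1 1 i)) (fun x => q1 _ _ _) x,
        qc (fun e => tl (e.1.1 2 i)) (fun x => q1 _ _ _) x, q2 _ _ _]
    · exact fun i x => q1 _ _ _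
    · exact fun i x => q1 _ _ _
    · exact fun i x => qc (fun e => e.2.1 0 (Sum.inl i)) (fun x => q3 _ _ _) x
  have o2 : LOpen k P2 := by
    apply LOpen_K
    · rintro (i | i | i) x
      exacts [q3 _ _ _, q3 _ _ _, q4 _ _ _]
    · rintro (i | i | i) x
      exacts [q3 _ _ _, q3 _ _ _, q4 _ _ _]
    · exact fun i x => q3 _ _ _
    · exact fun i x => q3 _ _ _
    · rintro (i | i | i) x
      exacts [q1 _ _ _, q1 _ _ _, q2 _ _ _]
  have o3 : LOpen k P3 := LOpen.iInter fun i => LOpen.ne_zero (q1 0 i 0)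
  have o4 : LOpen k P4 := LOpen.iInter fun i => LOpen.ne_zero (q2 1 i 0)
  have n34 : (P3 ∩ P4).Nonempty := by
    refine ⟨((1, 1), 0), ?_, ?_⟩
    · simp [P3]
    · simp [P4]
  have n1 : P1.Nonempty := by
    obtain ⟨S, L, w, h⟩ := res_nonempty hA hB
    exact ⟨((S, L), (fun _ => Sum.elim w 0, 0)), h⟩
  have n2 : P2.Nonempty := by
    obtain ⟨S, L, w, h⟩ := tr_nonempty (α := ι1 ⊕ ι1 ⊕ κ1) hC
    refine ⟨((![0, fun i => c0 (w (Sum.inl i)), fun i => c0 (w (Sum.inr (Sum.inl i))), 0],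
      fun _ i => c0 (w (Sum.inr (Sum.inr i)))), (S, L)), ?_⟩
    have hw : pt ((![0, fun i => c0 (w (Sum.inl i)), fun i => c0 (w (Sum.inr (Sum.inl i))), 0],
      fun _ i => c0 (w (Sum.inr (Sum.inr i)))), (S, L)) = w := by
      funext i
      rcases i with i | i | i <;> rfl
    change finrank k (Ktr (e+2) S L (pt _)) ≤ bd
    rw [hw]
    refine h.trans (le_of_eq ?_)
    simp only [Fintype.card_sum, hbd]
    omega
  obtain ⟨x, hx1, hx2, hx3, hx4⟩ := o1.nonempty_inter (o2.inter (o3.inter o4)) n1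
    (o2.nonempty_inter (o3.inter o4) n2 n34)
  obtain ⟨⟨SY, LY⟩, ⟨SZ, LZ⟩⟩ := x
  change finrank k (Kres (e+1) SY LY (fun i : ιc => SZ 0 (Sum.inl i))) ≤ 0 at hx1
  change finrank k (Ktr (e+2) SZ LZ (pt ((SY, LY), (SZ, LZ)))) ≤ bd at hx2
  have hS : ∀ i, SY 0 i 0 ≠ 0 := fun i => Set.mem_iInter.1 hx3 i
  have hL : ∀ i, LY 1 i 0 ≠ 0 := fun i => Set.mem_iInter.1 hx4 i
  let S : Fin 4 → (ι1 ⊕ (ιc ⊕ ιs)) → Fin (n+1) → k := fun j => Sum.elim (prS SY j)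
    (Sum.elim (fun i => if j = 3 then Pi.single 0 1 else c0 (SZ j (Sum.inl i)))
      (fun i => c0 (SZ j (Sum.inr i))))
  let L : Fin 2 → (κ1 ⊕ κ2) → Fin (n+1) → k := fun j => Sum.elim (prL LY j) (fun i => c0 (LZ j i))
  refine ⟨S, L, ?_⟩
  have key := horace (rhoL (e+2)) (mulX0 (e+1)) (KS (e+2) S L)
    (Ktr (e+2) SZ LZ (pt ((SY, LY), (SZ, LZ))))
    (Kres (e+1) SY LY (fun i : ιc => SZ 0 (Sum.inl i))) (by
      intro F hF
      rw [mem_KS] at hF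
      obtain ⟨f1, f2, f3, f4⟩ := hF
      rw [mem_Ktr]
      change (∀ i, vl (rho F.1) _ _) ∧ (∀ i, vl (rho F.1) _ _) ∧ (∀ i, vl (rho F.1) _ _) ∧
        (∀ i, dv _ _ (rho F.1) = 0) ∧ ∀ i, eval _ (rho F.1) = 0
      simp only [rho_vl, rho_dv, rho_eval]
      refine ⟨?_, ?_, fun j => f3 (Sum.inr j), fun i => f4 (Sum.inr (Sum.inr i)), ?_⟩
      · rintro (i | i)
        · exact f1 (Sum.inr (Sum.inl i))
        · exact f1 (Sum.inr (Sum.inr i))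
      · rintro (i | i)
        · exact f2 (Sum.inr (Sum.inl i))
        · exact f2 (Sum.inr (Sum.inr i))
      · rintro (i | i | i)
        · exact (f1 (Sum.inl i)).right
        · exact (f2 (Sum.inl i)).right
        · exact (f3 (Sum.inl i)).left) (by
      intro F hF h0
      obtain ⟨G, rfl⟩ := exists_mulX0 F (congrArg Subtype.val h0)
      refine ⟨G, ?_, rfl⟩
      rw [mem_KS] at hF
      obtain ⟨f1, f2, f3, f4⟩ := hF
      rw [mem_Kres]
      constructor
      · apply KS_residual
        · exact hS
        · exact hL
        · rw [mem_KS]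
          exact ⟨fun i => f1 (Sum.inl i), fun i => f2 (Sum.inl i), fun i => f3 (Sum.inl i),
            fun i => f4 (Sum.inl i)⟩
      · intro i
        have := f4 (Sum.inr (Sum.inl i))
        change dv (c0 (SZ 0 (Sum.inl i))) (Pi.single 0 1) (X 0 * G.1) = 0 at this
        rw [dv_mul, dv_X, eval_X, c0_zero] at this
        simpa using this)
  omega

end mainstep

section quadric

variable {k : Type} [Field k]

open Module in
lemma horace' {M M' M'' B : Type} [AddCommGroup M] [Module k M] [FiniteDimensional k M]
    [AddCommGroup M'] [Module k M'] [AddCommGroup B] [Module k B] [FiniteDimensional k B]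
    [AddCommGroup M''] [Module k M''] [FiniteDimensional k M'']
    (T : M →ₗ[k] M') (A : B →ₗ[k] M') (S : M'' →ₗ[k] M) (V : Submodule k M) (U : Submodule k B)
    (V'' : Submodule k M'') (h1 : ∀ v ∈ V, ∃ u ∈ U, A u = T v)
    (h2 : ∀ v ∈ V, T v = 0 → ∃ u ∈ V'', S u = v) :
    finrank k V ≤ finrank k U + finrank k V'' := by
  let P : V →ₗ[k] M' := T.comp V.subtype
  have e1 := LinearMap.finrank_range_add_finrank_ker P
  have e2 : finrank k (LinearMap.range P) ≤ finrank k U := by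
    refine (Submodule.finrank_mono (t := U.map A) ?_).trans (Submodule.finrank_map_le A U)
    rintro _ ⟨v, rfl⟩
    obtain ⟨u, hu, huv⟩ := h1 _ v.2
    exact ⟨u, hu, huv⟩
  have e3 : finrank k (LinearMap.ker P) ≤ finrank k V'' := by
    have : (LinearMap.ker P).map V.subtype ≤ V''.map S := by
      rintro _ ⟨v, hv, rfl⟩
      obtain ⟨u, hu, huv⟩ := h2 _ v.2 hv
      exact ⟨u, hu, huv⟩
    rw [(Submodule.equivMapOfInjective V.subtype V.injective_subtype (LinearMap.ker P)).finrank_eq]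
    exact (Submodule.finrank_mono this).trans (Submodule.finrank_map_le S V'')
  omega

/-- the quadric -/
noncomputable def Qp (k : Type) [Field k] : MvPolynomial (Fin 4) k := X 0 * X 3 - X 1 * X 2

lemma Qp_homog : (Qp k).IsHomogeneous 2 :=
  ((isHomogeneous_X k _).mul (isHomogeneous_X k _)).sub
    ((isHomogeneous_X k _).mul (isHomogeneous_X k _))

lemma Qp_eval (v : Fin 4 → k) : eval v (Qp k) = v 0 * v 3 - v 1 * v 2 := by simp [Qp]

/-- parametrization -/
def psi (s t : k) : Fin 4 → k := ![1, t, s, s * t]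

lemma psi_of {v : Fin 4 → k} (h0 : v 0 ≠ 0) (hQ : eval v (Qp k) = 0) :
    v = v 0 • psi (v 2 / v 0) (v 1 / v 0) := by
  rw [Qp_eval] at hQ
  ext i
  fin_cases i
  · simp [psi]
  · simp [psi]; field_simp
  · simp [psi]; field_simp
  · simp [psi]; field_simp; linear_combination hQ

lemma eval_aeval_comp {N M : ℕ} (g : Fin N → MvPolynomial (Fin M) k) (v : Fin M → k)
    (F : MvPolynomial (Fin N) k) : eval v (aeval g F) = eval (fun i => eval v (g i)) F := by
  induction F using MvPolynomial.induction_on with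
  | C r => simp
  | add p q hp hq => rw [map_add, map_add, map_add, hp, hq]
  | mul_X p i hp => rw [map_mul, map_mul, map_mul, hp, aeval_X, eval_X]

lemma aeval_sub_mem {N : ℕ} {A : Type} [CommRing A] [Algebra k A] (I : Ideal A) (f g : Fin N → A)
    (h : ∀ i, f i - g i ∈ I) (F : MvPolynomial (Fin N) k) : aeval f F - aeval g F ∈ I := by
  induction F using MvPolynomial.induction_on with
  | C r => simp
  | add p q hp hq =>
    rw [map_add, map_add]
    have := I.add_mem hp hq
    convert this using 1
    ring
  | mul_X p i hp =>
    rw [map_mul, map_mul, aeval_X, aeval_X]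
    have := I.add_mem (I.mul_mem_right (f i) hp) (I.mul_mem_left (aeval g p) (h i))
    convert this using 1
    ring

lemma aeval_mul_homog {N d : ℕ} {A : Type} [CommRing A] [Algebra k A] (z : A) (f : Fin N → A)
    {F : MvPolynomial (Fin N) k} (hF : F.IsHomogeneous d) :
    aeval (fun i => z * f i) F = z ^ d * aeval f F := by
  rw [aeval_def, aeval_def, eval₂_eq, eval₂_eq, Finset.mul_sum]
  refine Finset.sum_congr rfl fun m hm => ?_
  have hmd : ∑ i ∈ m.support, m i = d := by
    have := hF (mem_support_iff.1 hm)
    simpa [Finsupp.weight_apply, Finsupp.sum] using this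
  simp only [mul_pow, Finset.prod_mul_distrib]
  rw [Finset.prod_pow_eq_pow_sum, hmd]
  ring

lemma Qp_cancel {F G : MvPolynomial (Fin 4) k} (h : X 0 * F = Qp k * G) :
    ∃ G', F = Qp k * G' := by
  have h1 := congrArg (rho (n := 3)) h
  rw [map_mul, map_mul, rho_X0, zero_mul] at h1
  have hQ : rho (n := 3) (Qp k) ≠ 0 := by
    have : rho (n := 3) (Qp k) = - (X 0 * X 1) := by
      simp only [Qp, map_sub, map_mul, rho_X0]
      rw [show (1 : Fin 4) = Fin.succ 0 from rfl, show (2 : Fin 4) = Fin.succ 1 from rfl,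
        rho_Xs, rho_Xs]
      ring
    rw [this]
    exact neg_ne_zero.2 (mul_ne_zero (X_ne_zero _) (X_ne_zero _))
  have hG : rho (n := 3) G = 0 := (mul_eq_zero.1 h1.symm).resolve_left hQ
  obtain ⟨G', hG'⟩ := rho_sub (n := 3) G
  rw [hG, map_zero, sub_zero] at hG'
  refine ⟨G', mul_left_cancel₀ (X_ne_zero (R := k) (0 : Fin 4)) ?_⟩
  rw [h, hG']
  ring

lemma Qp_cancel_pow (m : ℕ) {F G : MvPolynomial (Fin 4) k} (h : X 0 ^ m * F = Qp k * G) :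
    ∃ G', F = Qp k * G' := by
  induction m generalizing G with
  | zero => exact ⟨G, by simpa using h⟩
  | succ m ih =>
    rw [pow_succ', mul_assoc] at h
    obtain ⟨G', h'⟩ := Qp_cancel h
    exact ih h'

lemma Qp_dvd [Infinite k] {e : ℕ} (F : Rf k 4 (e+2)) (h : ∀ s t, eval (psi s t) F.1 = 0) :
    ∃ G : Rf k 4 e, F.1 = Qp k * G.1 := by
  have hF : F.1.IsHomogeneous (e+2) := F.2
  let g : Fin 4 → MvPolynomial (Fin 4) k := ![X 0 * X 0, X 0 * X 1, X 0 * X 2, X 1 * X 2]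
  have h1 : aeval g F.1 = 0 := by
    apply mul_left_cancel₀ (X_ne_zero (R := k) (0 : Fin 4))
    rw [mul_zero]
    apply MvPolynomial.funext
    intro v
    rw [map_mul, eval_X, map_zero]
    by_cases hv : v 0 = 0
    · rw [hv, zero_mul]
    · have : eval v (aeval g F.1) = eval (fun i => eval v (g i)) F.1 := eval_aeval_comp _ _ _
      rw [this]
      have hv2 : (fun i => eval v (g i)) = (v 0 * v 0) • psi (v 2 / v 0) (v 1 / v 0) := by
        ext i
        fin_cases i <;> simp [g, psi] <;> field_simp
      rw [hv2, eval_smul_of_homog hF, h, mul_zero, mul_zero]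
  have h2 := aeval_sub_mem (k := k) (Ideal.span {Qp k}) (fun i => X 0 * X i) g (by
    intro i
    fin_cases i
    · simp [g]
    · simp [g]
    · simp [g]
    · exact Ideal.subset_span rfl) F.1
  rw [h1, sub_zero, aeval_mul_homog (X 0) X hF, aeval_X_left_apply,
    Ideal.mem_span_singleton] at h2
  obtain ⟨G, hG⟩ := h2
  obtain ⟨G', hG'⟩ := Qp_cancel_pow _ hG
  have hF' : F.1.IsHomogeneous (2+e) := by
    rw [add_comm 2 e]
    exact hF
  exact homog_quot hF' Qp_homog hG'

/-- multiplication by the quadric -/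
noncomputable def mulQ (d : ℕ) : Rf k 4 d →ₗ[k] Rf k 4 (d+2) where
  toFun F := ⟨Qp k * F.1, by
    have := (Qp_homog (k := k)).mul F.2
    rwa [add_comm 2 d] at this⟩
  map_add' F G := by ext1; simp [mul_add]
  map_smul' r F := by ext1; simp

/-- bipolynomials -/
noncomputable def biev {a b : ℕ} (s t : k) : (Fin a → Fin b → k) →ₗ[k] k where
  toFun u := ∑ j, (∑ i, u j i * s ^ (i : ℕ)) * t ^ (j : ℕ)
  map_add' u v := by simp [add_mul, Finset.sum_add_distrib]
  map_smul' r u := by simp [Finset.mul_sum, Finset.sum_mul, mul_assoc]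

lemma biev_apply {a b : ℕ} (s t : k) (u : Fin a → Fin b → k) :
    biev s t u = ∑ j, (∑ i, u j i * s ^ (i : ℕ)) * t ^ (j : ℕ) := rfl

lemma sum_pow_zero [Infinite k] {b : ℕ} (u : Fin b → k) (h : ∀ s, ∑ i, u i * s ^ (i : ℕ) = 0) :
    u = 0 := by
  let p := (Polynomial.degreeLTEquiv k b).symm u
  have hp : p.1 = 0 := by
    apply Polynomial.funext
    intro s
    rw [Polynomial.eval_eq_sum_degreeLTEquiv p.2]
    simpa [p] using h s
  have : p = 0 := Subtype.ext hp
  simpa [p] using this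

lemma biev_faithful [Infinite k] {a b : ℕ} (u : Fin a → Fin b → k) (h : ∀ s t, biev s t u = 0) :
    u = 0 := by
  have h1 : ∀ s, (fun j => ∑ i, u j i * s ^ (i : ℕ)) = 0 := fun s => sum_pow_zero _ (h s)
  funext j
  exact sum_pow_zero _ fun s => congrFun (h1 s) j

/-- coefficients of the trace -/
lemma trace_coeff {D : ℕ} (F : Rf k 4 D) : ∃ c : Fin (D+1) → Polynomial k,
    (∀ j, (c j).natDegree ≤ D) ∧
    ∀ s t, eval (psi s t) F.1 = ∑ j, (c j).eval s * t ^ (j : ℕ) := by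
  classical
  have hm : ∀ m ∈ F.1.support, m 0 + m 1 + m 2 + m 3 = D := by
    intro m hm
    have := F.2 (mem_support_iff.1 hm)
    rw [← this]
    rw [Finsupp.weight_apply, Finsupp.sum_fintype _ _ (by simp)]
    simp [Fin.sum_univ_four]
  let c : Fin (D+1) → Polynomial k := fun j => ∑ m ∈ F.1.support with m 1 + m 3 = (j : ℕ),
    Polynomial.C (coeff m F.1) * Polynomial.X ^ (m 2 + m 3)
  refine ⟨c, fun j => ?_, fun s t => ?_⟩
  · apply Polynomial.natDegree_sum_le_of_forall_le
    intro m hm'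
    simp only [Finset.mem_filter] at hm'
    have := hm m hm'.1
    refine (Polynomial.natDegree_C_mul_X_pow_le _ _).trans (by omega)
  · have e1 : ∀ j : Fin (D+1), (c j).eval s * t ^ (j : ℕ) =
        ∑ m ∈ F.1.support with m 1 + m 3 = (j : ℕ), coeff m F.1 * s ^ (m 2 + m 3) * t ^ (m 1 + m 3) := by
      intro j
      rw [Polynomial.eval_finsetSum, Finset.sum_mul]
      refine Finset.sum_congr rfl fun m hm' => ?_
      simp only [Finset.mem_filter] at hm'
      rw [hm'.2]
      simp
    simp only [e1]
    rw [eval_eq']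
    have e2 : ∀ m ∈ F.1.support, coeff m F.1 * ∏ i, psi s t i ^ m i =
        coeff m F.1 * s ^ (m 2 + m 3) * t ^ (m 1 + m 3) := by
      intro m _
      simp [Fin.prod_univ_four, psi]
      ring
    rw [Finset.sum_congr rfl e2]
    have := Finset.sum_fiberwise_of_maps_to (s := F.1.support) (t := Finset.range (D+1))
      (g := fun m => m 1 + m 3) (fun m hm' => by
        have := hm m hm'
        simp only [Finset.mem_range]
        omega) (fun m => coeff m F.1 * s ^ (m 2 + m 3) * t ^ (m 1 + m 3))
    rw [← this, Finset.sum_range]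

lemma trace_div [Infinite k] {D : ℕ} (F : Rf k 4 D) {Λ : Type} [Fintype Λ] (r : Λ → k)
    (hr : Function.Injective r) (h : ∀ l t, eval (psi (r l) t) F.1 = 0) :
    ∃ u : Fin (D+1) → Fin (D+1-Fintype.card Λ) → k, ∀ s t,
      eval (psi s t) F.1 = (∏ l, (s - r l)) * biev s t u := by
  obtain ⟨c, hc, hct⟩ := trace_coeff F
  have h0 : ∀ l j, (c j).eval (r l) = 0 := by
    intro l
    have := sum_pow_zero (fun j => (c j).eval (r l)) fun t => by rw [← hct, h]
    exact fun j => congrFun this j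
  let R : Polynomial k := ∏ l, (Polynomial.X - Polynomial.C (r l))
  have hR : R.Monic := Polynomial.monic_prod_of_monic _ _ fun l _ => Polynomial.monic_X_sub_C _
  have hRd : R.natDegree = Fintype.card Λ := by
    simp only [R]
    rw [Polynomial.natDegree_finsetProd_X_sub_C_eq_card]
    simp
  have hdvd : ∀ j, R ∣ c j := by
    intro j
    apply Finset.prod_dvd_of_coprime
    · intro l _ l' _ hl
      exact Polynomial.isCoprime_X_sub_C_of_isUnit_sub
        (isUnit_iff_ne_zero.2 (sub_ne_zero.2 (hr.ne hl)))
    · intro l _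
      exact Polynomial.dvd_iff_isRoot.2 (h0 l j)
  choose q hq using hdvd
  have hqd : ∀ j, q j ∈ Polynomial.degreeLT k (D+1-Fintype.card Λ) := by
    intro j
    rw [Polynomial.mem_degreeLT]
    by_cases h0 : q j = 0
    · rw [h0, Polynomial.degree_zero]
      exact WithBot.bot_lt_coe _
    · rw [← Polynomial.natDegree_lt_iff_degree_lt h0]
      have h1 := hc j
      rw [hq j, hR.natDegree_mul' h0, hRd] at h1
      omega
  refine ⟨fun j => Polynomial.degreeLTEquiv k _ ⟨q j, hqd j⟩, fun s t => ?_⟩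
  rw [hct, biev_apply, Finset.mul_sum]
  refine Finset.sum_congr rfl fun j _ => ?_
  rw [← Polynomial.eval_eq_sum_degreeLTEquiv (hqd j), hq j, Polynomial.eval_mul,
    Polynomial.eval_prod]
  simp [mul_assoc]

end quadric

section quadricstep

variable {k : Type} [Field k]

lemma biev_dv [Infinite k] {D b : ℕ} (F : MvPolynomial (Fin 4) k) {Λ : Type} [Fintype Λ] (r : Λ → k)
    (hr : Function.Injective r) (u : Fin D → Fin b → k)
    (hu : ∀ s t, eval (psi s t) F = (∏ l, (s - r l)) * biev s t u) (l0 : Λ) (t : k)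
    (hdv : dv (psi (r l0) t) ![0, 0, 1, t] F = 0) : biev (r l0) t u = 0 := by
  classical
  set σ := r l0 with hσ
  let Up : Polynomial k := ∑ j, (∑ i, Polynomial.C (u j i) * Polynomial.X ^ (i : ℕ)) *
    Polynomial.C (t ^ (j : ℕ))
  have hUp : ∀ s, Up.eval s = biev s t u := by
    intro s
    simp only [Up, Polynomial.eval_finsetSum, Polynomial.eval_mul, Polynomial.eval_C,
      Polynomial.eval_pow, Polynomial.eval_X, biev_apply]
  let R2 : Polynomial k := ∏ l ∈ Finset.univ.erase l0, (Polynomial.X - Polynomial.C (r l))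
  have hf : lpoly (psi σ t) ![0, 0, 1, t] F =
      Polynomial.X * ((R2 * Up).comp (Polynomial.X + Polynomial.C σ)) := by
    apply Polynomial.funext
    intro x
    rw [lpoly_eval]
    have e1 : psi σ t + x • ![0, 0, 1, t] = psi (x + σ) t := by
      ext i
      fin_cases i
      · simp [psi]
      · simp [psi]
      · simp [psi, add_comm]
      · simp [psi]; ring
    rw [e1, hu, ← Finset.mul_prod_erase _ _ (Finset.mem_univ l0)]
    simp [R2, Polynomial.eval_prod, hUp, hσ, mul_assoc]
  have h1 := lpoly_coeff_one (psi σ t) ![0, 0, 1, t] F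
  rw [hdv, hf, Polynomial.coeff_X_mul, Polynomial.coeff_zero_eq_eval_zero] at h1
  simp only [Polynomial.eval_comp, Polynomial.eval_add, Polynomial.eval_X, Polynomial.eval_C,
    zero_add, Polynomial.eval_mul, hUp] at h1
  refine (mul_eq_zero.1 h1).resolve_left ?_
  simp only [R2, Polynomial.eval_prod]
  refine Finset.prod_ne_zero_iff.2 ?_
  intro l hl
  simp only [Polynomial.eval_sub, Polynomial.eval_X, Polynomial.eval_C]
  exact sub_ne_zero.2 (fun h => Finset.ne_of_mem_erase hl (hr h).symm)

/-- a general line is a chord of the quadric -/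
lemma chord [IsAlgClosed k] [CharZero k] (a b : Fin 4 → k) (h1 : eval b (Qp k) ≠ 0)
    (h2 : (a 0 * b 3 + a 3 * b 0 - a 1 * b 2 - a 2 * b 1) ^ 2
      - 4 * eval a (Qp k) * eval b (Qp k) ≠ 0)
    (h3 : eval (b 0 • a - a 0 • b) (Qp k) ≠ 0) :
    ∃ w : Fin 4 → k, ∀ F : MvPolynomial (Fin 4) k,
      vl F (psi (w 0) (w 1)) (psi (w 2) (w 3)) → vl F a b := by
  set β := a 0 * b 3 + a 3 * b 0 - a 1 * b 2 - a 2 * b 1 with hβ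
  set qa := eval a (Qp k) with hqa
  set qb := eval b (Qp k) with hqb
  obtain ⟨δ, hδ⟩ := IsAlgClosed.exists_eq_mul_self (β ^ 2 - 4 * qa * qb)
  have hδ0 : δ ≠ 0 := by
    rintro rfl
    apply h2
    rw [hδ, mul_zero]
  have hroot : ∀ x : k, qa + x * β + x ^ 2 * qb = eval (a + x • b) (Qp k) := by
    intro x
    simp only [hqa, hqb, hβ, Qp_eval, Pi.add_apply, Pi.smul_apply, smul_eq_mul]
    ring
  have hy : ∀ x : k, qa + x * β + x ^ 2 * qb = 0 → (a + x • b) 0 ≠ 0 := by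
    intro x hx h0
    apply h3
    have : b 0 • a - a 0 • b = b 0 • (a + x • b) := by
      have : a 0 = - (x * b 0) := by
        simp only [Pi.add_apply, Pi.smul_apply, smul_eq_mul] at h0
        linear_combination h0
      rw [this]
      module
    rw [this, eval_smul_of_homog Qp_homog, ← hroot, hx, mul_zero]
  have two : (2 : k) ≠ 0 := two_ne_zero
  let x1 := (-β + δ) / (2 * qb)
  let x2 := (-β - δ) / (2 * qb)
  have r1 : qa + x1 * β + x1 ^ 2 * qb = 0 := by
    simp only [x1]
    field_simp
    linear_combination -hδ
  have r2 : qa + x2 * β + x2 ^ 2 * qb = 0 := by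
    simp only [x2]
    field_simp
    linear_combination -hδ
  have hx : x1 - x2 ≠ 0 := by
    have : x1 - x2 = δ / qb := by
      simp only [x1, x2]
      field_simp
      ring
    rw [this]
    exact div_ne_zero hδ0 h1
  have p1 := psi_of (hy x1 r1) (by rw [← hroot]; exact r1)
  have p2 := psi_of (hy x2 r2) (by rw [← hroot]; exact r2)
  set y1 := a + x1 • b with hy1
  set y2 := a + x2 • b with hy2
  refine ⟨![y1 2 / y1 0, y1 1 / y1 0, y2 2 / y2 0, y2 1 / y2 0], fun F hF => ?_⟩
  have g1 : vl F y1 y2 := hF.span (x := y1 0) (y := 0) (z := 0) (w := y2 0)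
    (by rw [zero_smul, add_zero]; exact p1) (by rw [zero_smul, zero_add]; exact p2)
  refine g1.span (x := 1 - x1 * (x1 - x2)⁻¹) (y := x1 * (x1 - x2)⁻¹) (z := (x1 - x2)⁻¹)
    (w := - (x1 - x2)⁻¹) ?_ ?_
  · ext i
    simp only [hy1, hy2, Pi.add_apply, Pi.smul_apply, smul_eq_mul]
    field_simp
    ring
  · ext i
    simp only [hy1, hy2, Pi.add_apply, Pi.smul_apply, smul_eq_mul]
    field_simp
    ring

open Module in
lemma chords [IsAlgClosed k] [CharZero k] {e b : ℕ} {J : Type} [Finite J]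
    (h : Good k 4 e Empty J b) :
    ∃ w : J → Fin 4 → k, finrank k (KS e (fun _ => (Empty.elim : Empty → Fin 4 → k))
      ![fun j => psi (w j 0) (w j 1), fun j => psi (w j 2) (w j 3)]) ≤ b := by
  obtain ⟨S, L, h⟩ := h
  let E := (Fin 4 → Empty → Fin 4 → k) × (Fin 2 → J → Fin 4 → k)
  have q : ∀ a i x, PolyOn k fun e : E => e.2 a i x := fun a i x =>
    proj_aux (E := E) (LinearMap.snd k _ _) a i x
  have qQ : ∀ f : E → Fin 4 → k, (∀ i, PolyOn k fun e => f e i) →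
      PolyOn k fun e => eval (f e) (Qp k) := fun f hf => PolyOn.evalMv hf _
  let f : J → E → k := fun j x => eval (x.2 1 j) (Qp k) *
    (((x.2 0 j 0 * x.2 1 j 3 + x.2 0 j 3 * x.2 1 j 0 - x.2 0 j 1 * x.2 1 j 2
      - x.2 0 j 2 * x.2 1 j 1) * (x.2 0 j 0 * x.2 1 j 3 + x.2 0 j 3 * x.2 1 j 0
      - x.2 0 j 1 * x.2 1 j 2 - x.2 0 j 2 * x.2 1 j 1)
      - 4 * eval (x.2 0 j) (Qp k) * eval (x.2 1 j) (Qp k)) *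
    eval (fun i => x.2 1 j 0 * x.2 0 j i - x.2 0 j 0 * x.2 1 j i) (Qp k))
  let P : J → Set E := fun j => {x | f j x ≠ 0}
  have hP : ∀ j, LOpen k (P j) := by
    intro j
    apply LOpen.ne_zero
    have hβ := ((((q 0 j 0).mul (q 1 j 3)).add ((q 0 j 3).mul (q 1 j 0))).sub
      ((q 0 j 1).mul (q 1 j 2))).sub ((q 0 j 2).mul (q 1 j 1))
    exact (qQ _ (q 1 j)).mul (((hβ.mul hβ).sub (((PolyOn.const 4).mul (qQ _ (q 0 j))).mul
      (qQ _ (q 1 j)))).mul (qQ _ fun i => ((q 1 j 0).mul (q 0 j i)).sub ((q 0 j 0).mul (q 1 j i))))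
  have hne : (⋂ j, P j).Nonempty := by
    refine ⟨(0, ![fun _ => ![1, 0, 0, 0], fun _ => ![0, 1, 1, 1]]), ?_⟩
    rw [Set.mem_iInter]
    intro j
    simp [P, f, Qp_eval]
  obtain ⟨x, hx1, hx2⟩ := (LOpen_KS (k := k) (N := 4) e Empty J b).nonempty_inter
    (LOpen.iInter hP) ⟨(S, L), h⟩ hne
  have hx : ∀ j, f j x ≠ 0 := fun j => Set.mem_iInter.1 hx2 j
  have hc : ∀ j, ∃ w : Fin 4 → k, ∀ F : MvPolynomial (Fin 4) k,
      vl F (psi (w 0) (w 1)) (psi (w 2) (w 3)) → vl F (x.2 0 j) (x.2 1 j) := by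
    intro j
    have h1 := left_ne_zero_of_mul (hx j)
    have h2 := right_ne_zero_of_mul (hx j)
    have h3 := left_ne_zero_of_mul h2
    have h4 := right_ne_zero_of_mul h2
    refine chord _ _ h1 ?_ h4
    rw [pow_two]
    exact h3
  choose w hw using hc
  refine ⟨w, le_trans (Submodule.finrank_mono ?_) hx1⟩
  intro F hF
  rw [mem_KS] at hF ⊢
  exact ⟨fun i => i.elim, fun i => i.elim, fun j => hw j _ (hF.2.2.1 j), fun i => i.elim⟩

open Module in
lemma quadric_step [IsAlgClosed k] [CharZero k] {e b : ℕ} {ι κ' τ' : Type} [Fintype ι] [Fintype κ']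
    [Fintype τ'] (h : Good k 4 e Empty (ι ⊕ κ') b) :
    Good k 4 (e+2) ι (κ' ⊕ τ') (b + ((e+2+1) * (e+2+1 - Fintype.card (ι ⊕ τ'))
      - 2 * Fintype.card (ι ⊕ κ'))) := by
  classical
  set x := Fintype.card (ι ⊕ τ') with hxdef
  set J := ι ⊕ κ' with hJ
  let B := Fin (e+2+1) → Fin (e+2+1-x) → k
  let E := (J → Fin 4 → k) × (τ' → k)
  have q : ∀ j i, PolyOn k fun y : E => y.1 j i := fun j i =>
    PolyOn.lin ((LinearMap.proj i).comp ((LinearMap.proj j).comp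
      (LinearMap.fst k (J → Fin 4 → k) (τ' → k))))
  have q' : ∀ j, PolyOn k fun y : E => y.2 j := fun j =>
    PolyOn.lin ((LinearMap.proj j).comp (LinearMap.snd k (J → Fin 4 → k) (τ' → k)))
  have qpsi : ∀ f g : E → k, PolyOn k f → PolyOn k g → ∀ i, PolyOn k fun y => psi (f y) (g y) i := by
    intro f g hf hg i
    fin_cases i
    · exact PolyOn.const 1
    · exact hg
    · exact hf
    · exact hf.mul hg
  let lines : E → Fin 2 → J → Fin 4 → k := fun y =>
    ![fun j => psi (y.1 j 0) (y.1 j 1), fun j => psi (y.1 j 2) (y.1 j 3)]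
  let P1 : Set E := {y | finrank k (KS e (fun _ => (Empty.elim : Empty → Fin 4 → k)) (lines y)) ≤ b}
  have o1 : LOpen k P1 := by
    apply LOpen_K
    · rintro (i | i | i) x
      exacts [i.elim, i.elim, qpsi _ _ (q _ _) (q _ _) x]
    · rintro (i | i | i) x
      exacts [i.elim, i.elim, qpsi _ _ (q _ _) (q _ _) x]
    · exact fun i => i.elim
    · exact fun i => i.elim
    · exact fun i => i.elim
  let Φ : E → (J ⊕ J) → (B →ₗ[k] k) := fun y => Sum.elim (fun j => biev (y.1 j 0) (y.1 j 1))
    (fun j => biev (y.1 j 2) (y.1 j 3))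
  have qpow : ∀ (f : E → k) (m : ℕ), PolyOn k f → PolyOn k fun y => f y ^ m := by
    intro f m hf
    simpa using hf.polyEval (Polynomial.X ^ m)
  have hΦ : ∀ l v, PolyOn k (fun y => Φ y l v) := by
    have : ∀ (f g : E → k) (v : B), PolyOn k f → PolyOn k g →
        PolyOn k fun y => biev (f y) (g y) v := by
      intro f g v hf hg
      simp only [biev_apply]
      exact PolyOn.sum _ fun j _ => (PolyOn.sum _ fun i _ => (PolyOn.const _).mul
        (qpow _ _ hf)).mul (qpow _ _ hg)
    rintro (j | j) v
    · exact this _ _ v (q j 0) (q j 1)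
    · exact this _ _ v (q j 2) (q j 3)
  let bd := (e+2+1) * (e+2+1-x) - 2 * Fintype.card J
  let P2 : Set E := {y | finrank k ↥(⨅ l, LinearMap.ker (Φ y l)) ≤ bd}
  have o2 : LOpen k P2 := LOpen.rank Φ hΦ bd
  let val : E → (J ⊕ J) ⊕ τ' → k := fun y => Sum.elim (Sum.elim (fun j => y.1 j 0)
    (fun j => y.1 j 2)) y.2
  have qval : ∀ l, PolyOn k fun y => val y l := by
    rintro ((j | j) | j)
    exacts [q _ _, q _ _, q' _]
  let P3 : Set E := ⋂ l : {l : ((J ⊕ J) ⊕ τ') × ((J ⊕ J) ⊕ τ') // l.1 ≠ l.2},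
    {y | val y l.1.1 - val y l.1.2 ≠ 0}
  have o3 : LOpen k P3 := LOpen.iInter fun l => LOpen.ne_zero ((qval _).sub (qval _))
  let P4 : Set E := ⋂ j : J, {y | y.1 j 1 - y.1 j 3 ≠ 0}
  have o4 : LOpen k P4 := LOpen.iInter fun l => LOpen.ne_zero ((q _ _).sub (q _ _))
  have n1 : P1.Nonempty := by
    obtain ⟨w, hw⟩ := chords h
    exact ⟨(w, 0), hw⟩
  have n2 : P2.Nonempty := by
    obtain ⟨w, hw⟩ := exists_points (M := B) (Ω := k × k) (fun z => biev z.1 z.2) ⊤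
      (fun v _ hv => biev_faithful v fun s t => hv (s, t)) (J ⊕ J)
    refine ⟨(fun j => ![(w (Sum.inl j)).1, (w (Sum.inl j)).2, (w (Sum.inr j)).1,
      (w (Sum.inr j)).2], 0), ?_⟩
    refine le_trans (Submodule.finrank_mono ?_) (hw.trans ?_)
    · intro v hv
      simp only [top_inf_eq, Submodule.mem_iInf] at hv ⊢
      rintro (j | j)
      · exact hv (Sum.inl j)
      · exact hv (Sum.inr j)
    · rw [finrank_top]
      simp only [B, Module.finrank_pi_fintype, Module.finrank_self, Finset.sum_const, Finset.card_univ,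
        Fintype.card_fin, smul_eq_mul, Fintype.card_sum, mul_one, bd]
      omega
  have n3 : P3.Nonempty := by
    obtain ⟨f⟩ : Nonempty (((J ⊕ J) ⊕ τ') ↪ k) := by
      obtain ⟨s, hs⟩ := Infinite.exists_subset_card_eq k (Fintype.card ((J ⊕ J) ⊕ τ'))
      exact ⟨(Fintype.equivOfCardEq (by simp [hs]) : ((J ⊕ J) ⊕ τ') ≃ s).toEmbedding.trans
        (Function.Embedding.subtype _)⟩
    refine ⟨(fun j => ![f (Sum.inl (Sum.inl j)), 0, f (Sum.inl (Sum.inr j)), 0],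
      fun j => f (Sum.inr j)), ?_⟩
    rw [Set.mem_iInter]
    rintro ⟨⟨l, l'⟩, hl⟩
    have : ∀ l, val (fun j => ![f (Sum.inl (Sum.inl j)), 0, f (Sum.inl (Sum.inr j)), 0],
      fun j => f (Sum.inr j)) l = f l := by
      rintro ((j | j) | j) <;> rfl
    change val _ l - val _ l' ≠ 0
    rw [this, this]
    exact sub_ne_zero.2 (f.injective.ne hl)
  have n4 : P4.Nonempty := by
    refine ⟨(fun j => ![0, 1, 0, 0], 0), ?_⟩
    rw [Set.mem_iInter]
    intro j
    simp
  obtain ⟨y, hy1, hy2, hy3, hy4⟩ := o1.nonempty_inter (o2.inter (o3.inter o4)) n1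
    (o2.nonempty_inter (o3.inter o4) n2 (o3.nonempty_inter o4 n3 n4))
  have hval : Function.Injective (val y) := by
    intro l l' hl
    by_contra hne
    exact Set.mem_iInter.1 hy3 ⟨(l, l'), hne⟩ (sub_eq_zero.2 hl)
  have htau : ∀ j, y.1 j 1 - y.1 j 3 ≠ 0 := fun j => Set.mem_iInter.1 hy4 j
  -- the configuration
  let S : Fin 4 → ι → Fin 4 → k := ![fun i => psi (y.1 (Sum.inl i) 0) (y.1 (Sum.inl i) 1),
    fun i => ![0, 1, 0, y.1 (Sum.inl i) 0],
    fun i => psi (y.1 (Sum.inl i) 2) (y.1 (Sum.inl i) 3),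
    fun i => ![0, 0, 1, y.1 (Sum.inl i) 1]]
  let L : Fin 2 → (κ' ⊕ τ') → Fin 4 → k := ![
    Sum.elim (fun j => psi (y.1 (Sum.inr j) 0) (y.1 (Sum.inr j) 1)) (fun j => ![1, 0, y.2 j, 0]),
    Sum.elim (fun j => psi (y.1 (Sum.inr j) 2) (y.1 (Sum.inr j) 3)) (fun j => ![0, 1, 0, y.2 j])]
  refine ⟨S, L, ?_⟩
  let emb : ι ⊕ τ' → (J ⊕ J) ⊕ τ' := Sum.elim (fun i => Sum.inl (Sum.inl (Sum.inl i))) Sum.inr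
  have hemb : Function.Injective emb := by
    rintro (i | i) (j | j) hij <;> simp [emb] at hij ⊢ <;> first | exact hij | exact Sum.inl_injective hij | exact Sum.inr_injective hij
  let r : ι ⊕ τ' → k := fun l => val y (emb l)
  have hr : Function.Injective r := hval.comp hemb
  let T : Rf k 4 (e+2) →ₗ[k] (k × k → k) := LinearMap.pi fun z =>
    (evL (psi z.1 z.2)).comp (Submodule.subtype _)
  let A : B →ₗ[k] (k × k → k) := LinearMap.pi fun z => (∏ l, (z.1 - r l)) • biev z.1 z.2
  have key := horace' T A (mulQ e) (KS (e+2) S L) (⨅ l, LinearMap.ker (Φ y l))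
    (KS e (fun _ => (Empty.elim : Empty → Fin 4 → k)) (lines y)) (by
      intro F hF
      rw [mem_KS] at hF
      obtain ⟨f1, f2, f3, f4⟩ := hF
      obtain ⟨u, hu⟩ := trace_div F r hr (by
        rintro (i | i) t
        · have := f1 i 1 (t - y.1 (Sum.inl i) 1)
          rw [← this]
          congr 2
          ext x
          fin_cases x
          · simp [S, psi]
          · simp [S, psi]
          · simp [S, psi, r, val, emb]
          · simp [S, psi, r, val, emb]; ring
        · have := f3 (Sum.inr i) 1 t
          rw [← this]
          congr 2
          ext x
          fin_cases x
          · simp [L, psi]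
          · simp [L, psi]
          · simp [L, psi, r, val, emb]
          · simp [L, psi, r, val, emb]; ring)
      have hpt : ∀ l t, (∀ l', emb l' ≠ l) → eval (psi (val y l) t) F.1 = 0 →
          biev (val y l) t u = 0 := by
        intro l t hl h0
        rw [hu] at h0
        refine (mul_eq_zero.1 h0).resolve_left ?_
        refine Finset.prod_ne_zero_iff.2 ?_
        intro l' _
        exact sub_ne_zero.2 fun h => hl l' (hval h).symm
      refine ⟨u, ?_, ?_⟩
      · simp only [Submodule.mem_iInf, LinearMap.mem_ker]
        rintro ((i | i) | (i | i))
        · exact biev_dv F.1 r hr u hu (Sum.inl i) _ (f4 i)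
        · exact hpt (Sum.inl (Sum.inl (Sum.inr i))) _ (by rintro (l | l) <;> simp [emb])
            (f3 (Sum.inl i)).left
        · exact hpt (Sum.inl (Sum.inr (Sum.inl i))) _ (by rintro (l | l) <;> simp [emb])
            (f2 i).right
        · exact hpt (Sum.inl (Sum.inr (Sum.inr i))) _ (by rintro (l | l) <;> simp [emb])
            (f3 (Sum.inl i)).right
      · funext z
        exact (hu z.1 z.2).symm) (by
      intro F hF h0
      obtain ⟨G, hG⟩ := Qp_dvd F fun s t => congrFun h0 (s, t)
      refine ⟨G, ?_, Subtype.ext hG.symm⟩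
      rw [mem_KS] at hF
      obtain ⟨f1, f2, f3, f4⟩ := hF
      rw [mem_KS]
      refine ⟨fun i => i.elim, fun i => i.elim, ?_, fun i => i.elim⟩
      intro j
      have hv : vl (Qp k * G.1) (lines y 0 j) (lines y 1 j) := by
        rw [← hG]
        rcases j with i | i
        · exact f2 i
        · exact f3 (Sum.inl i)
      refine vl_of_mul G.2 hv ⟨1, 1, ?_⟩
      have hs : y.1 j 0 - y.1 j 2 ≠ 0 := by
        apply sub_ne_zero.2
        have : val y (Sum.inl (Sum.inl j)) ≠ val y (Sum.inl (Sum.inr j)) := hval.ne (by simp)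
        exact this
      have : eval ((1 : k) • lines y 0 j + (1 : k) • lines y 1 j) (Qp k) =
          (y.1 j 0 - y.1 j 2) * (y.1 j 1 - y.1 j 3) := by
        simp [Qp_eval, lines, psi]
        ring
      rw [this]
      exact mul_ne_zero hs (htau j))
  have hy1' : finrank k (KS e (fun _ => (Empty.elim : Empty → Fin 4 → k)) (lines y)) ≤ b := hy1
  have hy2' : finrank k ↥(⨅ l, LinearMap.ker (Φ y l)) ≤ bd := hy2
  calc finrank k (KS (e+2) S L) ≤ _ := key
    _ ≤ bd + b := add_le_add hy2' hy1'
    _ = b + bd := add_comm _ _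

end quadricstep

/-- number of degree `d` monomials in `n+1` variables -/
def NN (n d : ℕ) : ℕ := (d+n).choose n

lemma NN_zero (n : ℕ) : NN n 0 = 1 := by simp [NN]

lemma NN_pascal (n d : ℕ) : NN (n+1) (d+1) = NN (n+1) d + NN n (d+1) := by
  unfold NN
  have := Nat.choose_succ_succ (d+1+n) n
  rw [show d+1+(n+1) = (d+1+n)+1 by ring, show d + (n+1) = d+1+n by ring]
  rw [Nat.succ_eq_add_one, Nat.succ_eq_add_one] at this
  omega

lemma NN_absorb (n d : ℕ) : (d+1) * NN n (d+1) = (d+1+n) * NN n d := by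
  unfold NN
  have h := Nat.add_one_mul_choose_eq (d+n) d
  rw [Nat.choose_symm_add, ← Nat.choose_symm_of_eq_add (show d+n+1 = n + (d+1) by ring)] at h
  rw [show d+1+n = d+n+1 by ring, h]; ring

lemma NN_one (d : ℕ) : NN 1 d = d+1 := by simp [NN]

lemma NN_two (d : ℕ) : 2 * NN 2 d = (d+1)*(d+2) := by
  induction d with
  | zero => simp [NN]
  | succ d ih => rw [NN_pascal, NN_one]; linarith

lemma NN_three (d : ℕ) : 6 * NN 3 d = (d+1)*(d+2)*(d+3) := by
  induction d with
  | zero => simp [NN]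
  | succ d ih => rw [NN_pascal]; linarith [NN_two (d+1)]

lemma NN_four (d : ℕ) : 24 * NN 4 d = (d+1)*(d+2)*(d+3)*(d+4) := by
  induction d with
  | zero => simp [NN]
  | succ d ih => rw [NN_pascal]; linarith [NN_three (d+1)]

lemma NN_five (d : ℕ) : 120 * NN 5 d = (d+1)*(d+2)*(d+3)*(d+4)*(d+5) := by
  induction d with
  | zero => simp [NN]
  | succ d ih => rw [NN_pascal]; linarith [NN_four (d+1)]

lemma NN_mono (n d : ℕ) (hn : 5 ≤ n) : NN 5 d ≤ NN n d := by
  induction n, hn using Nat.le_induction with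
  | base => exact le_rfl
  | succ n hn ih =>
    refine ih.trans ?_
    cases d with
    | zero => simp [NN]
    | succ d => rw [NN_pascal]; omega

lemma NN_quad (e : ℕ) : NN 3 (e+2) = NN 3 e + (e+3)*(e+3) := by
  have := NN_three e
  have h2 := NN_three (e+2)
  have : 6 * NN 3 (e+2) = 6 * (NN 3 e + (e+3)*(e+3)) := by linarith
  omega

section
variable {k : Type} [Field k] [IsAlgClosed k] [CharZero k]

lemma quadN {e σ x m : ℕ} (h : GoodN k 4 e 0 σ (NN 3 e - σ*(e+1))) (hσ : σ*(e+1) ≤ NN 3 e)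
    (hm : m ≤ σ) (hmx : m ≤ x) (hx : x ≤ e+3) (h2 : 2*σ ≤ (e+3)*(e+3-x)) :
    (σ+x)*(e+3) ≤ NN 3 (e+2) ∧ GoodN k 4 (e+2) m (σ+x-2*m) (NN 3 (e+2) - (σ+x)*(e+3)) := by
  have hq := NN_quad e
  have e1 : (e+3)*(e+3) = (e+3)*x + (e+3)*((e+3)-x) := by rw [← mul_add]; congr 1; omega
  have e2 : (σ+x)*(e+3) = σ*(e+1) + 2*σ + (e+3)*x := by ring
  refine ⟨by omega, ?_⟩
  have := quadric_step (h.toT Empty (Fin m ⊕ Fin (σ-m)) (by simp) (by simp; omega))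
    (τ' := Fin (x-m))
  refine this.toN (by simp) (by simp; omega) ?_
  simp only [Fintype.card_sum, Fintype.card_fin]
  rw [show m + (x-m) = x by omega, show m + (σ-m) = σ by omega]
  rw [show e+2+1 = e+3 by ring]
  omega

def lamE : ℕ → ℕ
  | 0 => 1
  | f+1 => lamE f + (f+2)

def lamO : ℕ → ℕ
  | 0 => 2
  | f+1 => lamO f + (f+3)

lemma lamE_eq (f : ℕ) : 2 * lamE f = (f+1)*(f+2) := by
  induction f with
  | zero => simp [lamE]
  | succ f ih => simp only [lamE]; linarith

lemma lamO_eq (f : ℕ) : 2 * lamO f = (f+1)*(f+4) := by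
  induction f with
  | zero => simp [lamO]
  | succ f ih => simp only [lamO]; linarith

lemma linesE (f : ℕ) : lamE f * (2*f+1) ≤ NN 3 (2*f) ∧
    GoodN k 4 (2*f) 0 (lamE f) (NN 3 (2*f) - lamE f * (2*f+1)) := by
  induction f with
  | zero => exact ⟨by simp [lamE, NN], good_zero (n := 3) 1⟩
  | succ f ih =>
    have h := lamE_eq f
    have := quadN (m := 0) (x := f+2) ih.2 ih.1 (by omega) (by omega) (by omega) (by
      rw [h, show 2*f+3-(f+2) = f+1 by omega]; nlinarith)
    exact this

lemma linesO (f : ℕ) : lamO f * (2*f+1+1) ≤ NN 3 (2*f+1) ∧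
    GoodN k 4 (2*f+1) 0 (lamO f) (NN 3 (2*f+1) - lamO f * (2*f+1+1)) := by
  induction f with
  | zero => exact ⟨by simp [lamO, NN, Nat.choose], good_one (n := 3) 2⟩
  | succ f ih =>
    have h := lamO_eq f
    have := quadN (m := 0) (x := f+3) ih.2 ih.1 (by omega) (by omega) (by omega) (by
      rw [h, show 2*f+1+3-(f+3) = f+1 by omega]; nlinarith)
    exact this

lemma dropN {N d m l lam b c : ℕ} (h : GoodN k N d m l b) (hl : lam ≤ l) 
    (hb : b + (l-lam)*(d+1) ≤ c) : GoodN k N d m lam c := by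
  obtain ⟨j, rfl⟩ := Nat.exists_eq_add_of_le hl
  refine (GoodN.drop j h).mono ?_
  simpa using hb

lemma lines3 {e σ lam : ℕ} (h : lam * (e+1) ≤ NN 3 e ∧ GoodN k 4 e 0 lam (NN 3 e - lam*(e+1)))
    (hl : σ ≤ lam) : σ * (e+1) ≤ NN 3 e ∧ GoodN k 4 e 0 σ (NN 3 e - σ*(e+1)) := by
  have h1 : σ * (e+1) ≤ lam * (e+1) := Nat.mul_le_mul_right _ hl
  refine ⟨h1.trans h.1, dropN h.2 hl ?_⟩
  have := h.1
  rw [Nat.sub_mul]; omega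

/-- the trace statement in `ℙ³` -/
lemma trace3 {e s m x lam : ℕ}
    (h : lam * (e+1) ≤ NN 3 e ∧ GoodN k 4 e 0 lam (NN 3 e - lam*(e+1)))
    (h1 : s ≤ lam + x) (h2 : m ≤ x) (h3 : m + x ≤ s) (hx : x ≤ e+3)
    (h4 : 2*(s-x) ≤ (e+3)*(e+3-x)) :
    s*(e+3) ≤ NN 3 (e+2) ∧ GoodN k 4 (e+2) m (s-2*m) (NN 3 (e+2) - s*(e+3)) := by
  have h5 := lines3 h (σ := s-x) (by omega)
  have := quadN (m := m) (x := x) h5.2 h5.1 (by omega) h2 hx h4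
  rwa [show s - x + x = s by omega] at this

end

lemma div_four {A d R : ℕ} (h : 4 * A = (d+1) * R) :
    A / (d+1) = R / 4 ∧ (A + d) / (d+1) = (R+3)/4 := by
  have hR := Nat.div_add_mod R 4
  have hm := Nat.mod_lt R (show 0 < 4 by norm_num)
  set a := R / 4
  set ρ := R % 4
  have h2 : 4 * A = 4 * ((d+1)*a) + (d+1) * ρ := by rw [h, ← hR]; ring
  have c1 : (d+1) * a = a * (d+1) := mul_comm _ _
  constructor
  · apply Nat.div_eq_of_lt_le
    · omega
    · have : (d+1) * ρ ≤ (d+1)*3 := Nat.mul_le_mul_left _ (by omega)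
      have : (a+1)*(d+1) = a*(d+1) + (d+1) := by ring
      omega
  · rcases Nat.eq_zero_or_pos ρ with h0 | h0
    · rw [h0] at h2
      rw [show (R+3)/4 = a by omega]
      apply Nat.div_eq_of_lt_le
      · omega
      · have : (a+1)*(d+1) = a*(d+1) + (d+1) := by ring
        omega
    · rw [show (R+3)/4 = a+1 by omega]
      have g1 : (d+1) * ρ ≤ (d+1)*3 := Nat.mul_le_mul_left _ (by omega)
      have g2 : (d+1) * 1 ≤ (d+1)*ρ := Nat.mul_le_mul_left _ (by omega)
      have g3 : (a+1)*(d+1) = a*(d+1) + (d+1) := by ring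
      have g4 : (a+1+1)*(d+1) = a*(d+1) + 2*(d+1) := by ring
      apply Nat.div_eq_of_lt_le
      · omega
      · omega

lemma NN_43 (d : ℕ) : 4 * NN 4 d = (d+1) * NN 3 (d+1) := by
  have h1 := NN_four d
  have h2 := NN_three (d+1)
  have : 6 * (4 * NN 4 d) = 6 * ((d+1) * NN 3 (d+1)) := by
    rw [show 6 * ((d+1) * NN 3 (d+1)) = (d+1) * (6 * NN 3 (d+1)) by ring, h2]; linarith
  omega

lemma NN3_odd (f : ℕ) : 4 ∣ NN 3 (2*f+1) := by
  have h1 := NN_three (2*f+1)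
  have h2 := NN_two f
  have : 6 * NN 3 (2*f+1) = 8 * (NN 2 f * (2*f+3)) := by
    rw [h1, show 8 * (NN 2 f * (2*f+3)) = 4 * ((2 * NN 2 f) * (2*f+3)) by ring, h2]; ring
  omega

section
variable (k : Type) [Field k] [IsAlgClosed k] [CharZero k]

/-- numerical and geometric input for the inductive step -/
def StepH (n e : ℕ) : Prop :=
  ∀ r, (r = NN (n+1) (e+2) / (e+3) ∨ r = (NN (n+1) (e+2) + (e+2)) / (e+3)) →
    ∀ u q m, NN (n+1) (e+1) = u*(e+2)+q → q < e+2 → m = max q 1 →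
    ∃ s, r = u + s ∧ 2*m ≤ s ∧ 2*(e+1-m) ≤ u ∧ (NN (n+1) e + e)/(e+1) + (e+1-m) ≤ u ∧
      s*(e+3) ≤ NN n (e+2) ∧ GoodN k (n+1) (e+2) m (s-2*m) (NN n (e+2) - s*(e+3))

set_option maxHeartbeats 4000000 in
lemma step4 (e : ℕ) : StepH k 3 e := by
  intro r hr u q m hw hq hm
  have hA := div_four (NN_43 (e+2))
  have hB := div_four (NN_43 e)
  have hC := NN_43 (e+1)
  simp only [show 3+1 = 4 by rfl] at *
  rw [show e+2+1 = e+3 by ring] at *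
  rw [show e+1+1 = e+2 by ring] at *
  rw [hB.2]
  rw [hA.1, hA.2] at hr
  clear hA hB
  have p1 := NN_pascal 2 (e+2)
  have p2 := NN_pascal 2 (e+1)
  simp only [show 2+1 = 3 by rfl, show e+2+1 = e+3 by ring, show e+1+1=e+2 by ring] at p1 p2
  have hP := NN_three (e+2)
  rw [hw] at hC
  have hu4 : 4*u ≤ NN 3 (e+2) := by
    have : (e+2) * (4*u) ≤ (e+2) * NN 3 (e+2) := by rw [← hC]; linarith
    exact Nat.le_of_mul_le_mul_left this (by omega)
  obtain ⟨ρ, hρ⟩ := Nat.exists_eq_add_of_le hu4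
  rw [hρ] at hC
  have hq4 : 4*q = (e+2)*ρ := by linarith
  have hρ4 : ρ < 4 := by
    by_contra h
    have : (e+2)*4 ≤ (e+2)*ρ := Nat.mul_le_mul_left _ (by omega)
    omega
  have hu2 : 2*(e+1-m) ≤ u := by
    have : 12 * (e*e) + 47*e+60 ≤ 6 * NN 3 (e+2) := by rw [hP]; nlinarith [Nat.zero_le (e*e*e)]
    have h3 : e ≤ e*e ∨ e = 0 := by
      rcases Nat.eq_zero_or_pos e with h | h
      · right; exact h
      · left; nlinarith
    omega
  clear hC hw hP
  rcases Nat.even_or_odd' e with ⟨f, rfl | rfl⟩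
  · have o1 := NN3_odd f
    have o2 := NN3_odd (f+1)
    rw [show 2*(f+1)+1 = 2*f+3 by ring] at o2
    have n1 := NN_two (2*f+3)
    have n2 := NN_two (2*f+2)
    have hl := lamE_eq f
    have hL := linesE (k := k) f
    obtain ⟨F, hF⟩ : ∃ F, F = f*f := ⟨_, rfl⟩
    have n1' : NN 2 (2*f+3) = 2*F+9*f+10 := by rw [hF]; linarith
    have n2' : NN 2 (2*f+2) = 2*F+7*f+6 := by rw [hF]; linarith
    have hl' : 2 * lamE f = F + 3*f+2 := by rw [hl, hF]; ring
    have hq5 : 2*q = (f+1)*ρ := by linarith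
    have hu3 : (NN 3 (2*f+1)+3)/4 + (2*f+1-m) ≤ u := by
      have : f ≤ F := by rw [hF]; nlinarith [Nat.le_mul_self f]
      interval_cases ρ <;> omega
    refine ⟨r-u, by omega, ?_⟩
    have main : ∃ x, r-u ≤ lamE f + x ∧ m ≤ x ∧ m + x ≤ r-u ∧ x ≤ 2*f+3 ∧
        2*((r-u)-x) ≤ (2*f+3)*(2*f+3-x) := by
      rcases Nat.lt_or_ge f 2 with h2 | h2
      · interval_cases f
        · have : NN 3 2 = 10 := by simp [NN, Nat.choose]
          simp only [Nat.mul_zero, Nat.zero_add] at *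
          have h0 : ρ = 2 := by omega
          subst h0
          refine ⟨2, ?_, ?_, ?_, ?_, ?_⟩ <;> omega
        · have : NN 3 4 = 35 := by simp [NN, Nat.choose]
          simp only [Nat.mul_one, Nat.reduceAdd] at *
          have h0 : ρ = 3 := by omega
          subst h0
          refine ⟨3, ?_, ?_, ?_, ?_, ?_⟩ <;> omega
      · have h5 : 2*f ≤ F := by rw [hF]; nlinarith
        refine ⟨(6*f+9)/4, ?_, ?_, ?_, ?_, ?_⟩
        · interval_cases ρ <;> omega
        · interval_cases ρ <;> omega
        · interval_cases ρ <;> omega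
        · omega
        · obtain ⟨y, hy⟩ : ∃ y, y = 2*f+3-(6*f+9)/4 := ⟨_, rfl⟩
          rw [← hy]
          have hy4 : 2*f+3 ≤ 4*y := by omega
          have : 4*F+12*f+9 ≤ 4*((2*f+3)*y) := by rw [hF]; nlinarith
          interval_cases ρ <;> omega
    obtain ⟨x, x1, x2, x3, x4, x5⟩ := main
    have := trace3 hL x1 x2 x3 x4 x5
    exact ⟨by omega, hu2, hu3, this⟩
  · have o2 := NN3_odd (f+1)
    rw [show 2*(f+1)+1 = 2*f+1+2 by ring] at o2
    have n1 := NN_two (2*f+1+3)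
    have n2 := NN_two (2*f+1+2)
    have hl := lamO_eq f
    have hL := linesO (k := k) f
    obtain ⟨F, hF⟩ : ∃ F, F = f*f := ⟨_, rfl⟩
    have n1' : NN 2 (2*f+1+3) = 2*F+11*f+15 := by rw [hF]; linarith
    have n2' : NN 2 (2*f+1+2) = 2*F+9*f+10 := by rw [hF]; linarith
    have hl' : 2 * lamO f = F + 5*f+4 := by rw [hl, hF]; ring
    have h0 : ρ = 0 := by omega
    subst h0
    have h5 : f ≤ F := by rw [hF]; nlinarith [Nat.le_mul_self f]
    have hu3 : (NN 3 (2*f+1+1)+3)/4 + (2*f+1+1-m) ≤ u := by omega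
    refine ⟨r-u, by omega, ?_⟩
    have x5 : 2*((r-u)-(f+2)) ≤ (2*f+1+3)*(2*f+1+3-(f+2)) := by
      rw [show 2*f+1+3-(f+2) = f+2 by omega]
      have : (2*f+1+3)*(f+2) = 2*F+8*f+8 := by rw [hF]; ring
      omega
    have := trace3 (m := m) (x := f+2) (s := r-u) hL (by omega) (by omega) (by omega) (by omega) x5
    exact ⟨by omega, hu2, hu3, this⟩
end

section
variable (k : Type) [Field k] [IsAlgClosed k] [CharZero k]

def SS (n d : ℕ) : Prop :=
  ∀ r, (r = NN n d / (d+1) ∨ r = (NN n d + d) / (d+1)) →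
    2*(d-1) ≤ r ∧ ∀ m ≤ d-1, GoodN k (n+1) d m (r-2*m) (NN n d - r*(d+1))

lemma floor_ceil {A d r : ℕ} (h : r = A / (d+1) ∨ r = (A + d) / (d+1)) :
    r*(d+1) ≤ A + d ∧ A ≤ r*(d+1) + d := by
  rcases h with rfl | rfl
  · have h1 := Nat.div_add_mod A (d+1)
    have h2 := Nat.mod_lt A (show 0 < d+1 by omega)
    rw [mul_comm] at h1
    omega
  · have h1 := Nat.div_add_mod (A+d) (d+1)
    have h2 := Nat.mod_lt (A+d) (show 0 < d+1 by omega)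
    rw [mul_comm] at h1
    omega

lemma step5 (n e : ℕ) (hn : 4 ≤ n) (hS : SS k n (e+2)) : StepH k n e := by
  intro r hr u q m hw hq hm
  obtain ⟨r1, r2⟩ := floor_ceil hr
  have pA := NN_pascal n (e+1)
  have aA := NN_absorb (n+1) (e+1)
  have aw := NN_absorb (n+1) e
  simp only [show e+1+1 = e+2 by ring, show e+2+1 = e+3 by ring] at *
  have w5 := NN_mono (n+1) (e+1) (by omega)
  have v5 := NN_mono (n+1) e (by omega)
  have w5' := NN_five (e+1)
  have v5' := NN_five e
  set A := NN (n+1) (e+2)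
  set w := NN (n+1) (e+1)
  set v := NN (n+1) e
  set T := NN n (e+2)
  have hT : (e+2)*T = (n+1)*w := by
    rw [pA] at aA; nlinarith
  have w6 : (e+2)*(e*e+6*e+6) ≤ 2*w := by
    have : (e+2)*(60*(e*e+6*e+6)) ≤ (e+2)*((e+3)*(e+4)*(e+5)*(e+6)) := by
      apply Nat.mul_le_mul_left
      have h3 : e ≤ e*e := Nat.le_mul_self e
      nlinarith [Nat.zero_le (e*e*e), Nat.zero_le (e*e*(e*e))]
    have h4 : (e+2)*((e+3)*(e+4)*(e+5)*(e+6)) = 120 * NN 5 (e+1) := by rw [w5']; ring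
    have h5 : (e+2)*(60*(e*e+6*e+6)) = 60 * ((e+2)*(e*e+6*e+6)) := by ring
    omega
  have u6 : e*e+6*e+5 ≤ 2*u := by
    by_contra h
    have : (e+2)*(2*u+2) ≤ (e+2)*(e*e+6*e+6) := Nat.mul_le_mul_left _ (by omega)
    have h2 : (e+2)*(2*u+2) = 2 * (u*(e+2)) + 2 * (e+2) := by ring
    omega
  have v6 : (e+1)*(e*e+3*e+1) ≤ 4*v := by
    have : (e+1)*(30*(e*e+3*e+1)) ≤ (e+1)*((e+2)*(e+3)*(e+4)*(e+5)) := by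
      apply Nat.mul_le_mul_left
      nlinarith [Nat.zero_le (e*e*e), Nat.zero_le (e*e*(e*e))]
    have h4 : (e+1)*((e+2)*(e+3)*(e+4)*(e+5)) = 120 * NN 5 e := by rw [v5']; ring
    have h5 : (e+1)*(30*(e*e+3*e+1)) = 30 * ((e+1)*(e*e+3*e+1)) := by ring
    omega
  have hee : e ≤ e*e := Nat.le_mul_self e
  have hu : 2*e+3 ≤ u := by
    rcases Nat.eq_zero_or_pos e with rfl | h
    · omega
    · omega
  have hT5 : 5*u ≤ T := by
    have : (e+2)*(5*u) ≤ (e+2)*T := by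
      rw [hT]
      have : 5*w ≤ (n+1)*w := Nat.mul_le_mul_right _ (by omega)
      have h2 : (e+2)*(5*u) = 5*(u*(e+2)) := by ring
      omega
    exact Nat.le_of_mul_le_mul_left this (by omega)
  have hur : u + 2*m ≤ r := by
    by_contra h
    have : r*(e+3) ≤ (u+(2*e+1))*(e+3) := Nat.mul_le_mul_right _ (by omega)
    have h2 : (u+(2*e+1))*(e+3) = u*(e+2) + u + (2*(e*e)+7*e+3) := by ring
    omega
  obtain ⟨s, rfl⟩ := Nat.exists_eq_add_of_le (show u ≤ r by omega)
  have hs : s*(e+3) ≤ T := by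
    have : (u+s)*(e+3) = u*(e+2) + u + s*(e+3) := by ring
    omega
  have hts : (v+e)/(e+1) + (e+1-m) ≤ u := by
    have h1 : v ≤ (u-e)*(e+1) := by
      obtain ⟨u', rfl⟩ := Nat.exists_eq_add_of_le (show e ≤ u by omega)
      rw [Nat.add_sub_cancel_left]
      refine Nat.le_of_mul_le_mul_left (c := e+2) ?_ (by omega)
      rw [hw] at aw
      have h3 : (e+2)*v + 4*v ≤ (e+1+(n+1))*v := by
        rw [← add_mul]; exact Nat.mul_le_mul_right _ (by omega)
      have h4 : (e+1)*q ≤ (e+1)*(e+1) := Nat.mul_le_mul_left _ (by omega)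
      have h5 : (e+1)*((e+u')*(e+2)+q) = (e+2)*(u'*(e+1)) + (e+1)*(e*e+2*e) + (e+1)*q := by ring
      have h6 : (e+1)*(e*e+3*e+1) = (e+1)*(e*e+2*e) + (e+1)*(e+1) := by ring
      omega
    have h2 : (v+e)/(e+1) ≤ u-e := by
      rw [← Nat.lt_succ_iff, Nat.div_lt_iff_lt_mul (by omega)]
      have : (u-e).succ*(e+1) = (u-e)*(e+1) + (e+1) := by rw [Nat.succ_mul]
      omega
    omega
  refine ⟨s, rfl, by omega, by omega, hts, hs, ?_⟩
  have ht : s ≤ T/(e+3) := (Nat.le_div_iff_mul_le (by omega)).2 hs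
  have hG := (hS (T/(e+3)) (Or.inl rfl)).2 m (by omega)
  refine dropN hG (by omega) ?_
  have g1 := Nat.div_mul_le_self T (e+3)
  obtain ⟨j, hj⟩ := Nat.exists_eq_add_of_le ht
  rw [hj] at g1 ⊢
  rw [show s+j-2*m-(s-2*m) = j by omega]
  simp only [show e+2+1 = e+3 by ring]
  have : (s+j)*(e+3) = s*(e+3)+j*(e+3) := by ring
  change T - (s+j)*(e+3) + j*(e+3) ≤ T - s*(e+3)
  omega

lemma SS_step (n e : ℕ) (H : StepH k n e) (h0 : SS k (n+1) e) (h1 : SS k (n+1) (e+1)) :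
    SS k (n+1) (e+2) := by
  intro r hr
  have hdm := Nat.div_add_mod (NN (n+1) (e+1)) (e+2)
  have hq := Nat.mod_lt (NN (n+1) (e+1)) (show 0 < e+2 by omega)
  obtain ⟨u, hu⟩ : ∃ u, u = NN (n+1) (e+1) / (e+2) := ⟨_, rfl⟩
  obtain ⟨q, hqq⟩ : ∃ q, q = NN (n+1) (e+1) % (e+2) := ⟨_, rfl⟩
  rw [← hu, ← hqq] at hdm
  rw [← hqq] at hq
  have hw : NN (n+1) (e+1) = u*(e+2)+q := by rw [← hdm]; ring
  obtain ⟨m, hm⟩ : ∃ m, m = max q 1 := ⟨_, rfl⟩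
  obtain ⟨s, rfl, s1, s2, s3, s4, hC⟩ := H r hr u q m hw hq hm
  have hA := (h1 u (Or.inl hu)).2 (e+1-m) (by omega)
  have hB := (h0 _ (Or.inr rfl)).2 0 (by omega)
  have hB0 : NN (n+1) e - (NN (n+1) e + e)/(e+1) * (e+1) = 0 := by
    have := (floor_ceil (Or.inr rfl : (NN (n+1) e + e)/(e+1) = NN (n+1) e / (e+1) ∨
      (NN (n+1) e + e)/(e+1) = (NN (n+1) e + e)/(e+1))).2
    have h3 := Nat.div_add_mod (NN (n+1) e + e) (e+1)
    have h4 := Nat.mod_lt (NN (n+1) e + e) (show 0 < e+1 by omega)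
    rw [mul_comm] at h3
    omega
  rw [hB0] at hB
  have hB' : GoodN k (n+1+1) e (e+1-m) (u-2*(e+1-m)) 0 := GoodN.extend hB (by omega)
  have hA' : GoodN k (n+1+1) (e+1) (e+1-m) (u-2*(e+1-m)) q := hA.mono (by
    simp only [show e+1+1 = e+2 by ring]; omega)
  have key := horace_step (ι1 := Fin (e+1-m)) (κ1 := Fin (u-2*(e+1-m))) (ιc := Fin q)
    (ιs := Fin (m-q)) (κ2 := Fin (s-2*m)) (by rw [Fintype.card_fin]; exact hA') hB'
    (hC.toT _ _ (by simp; omega) (by simp))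
  have hp := NN_pascal n (e+1)
  have key2 : GoodN k (n+1+1) (e+2) (e+1) (u+s-2*(e+1)) (NN (n+1) (e+2) - (u+s)*(e+2+1)) := by
    refine key.toN (by simp; omega) (by simp; omega) ?_
    simp only [Fintype.card_fin]
    simp only [show e+1+1 = e+2 by ring, show e+2+1 = e+3 by ring] at *
    have : (u+s)*(e+3) = u*(e+2) + u + s*(e+3) := by ring
    omega
  refine ⟨by omega, fun m' hm' => ?_⟩
  obtain ⟨j, hj⟩ := Nat.exists_eq_add_of_le (show m' ≤ e+1 by omega)
  have key3 := GoodN.deform_many (m := m') j (by rw [← hj]; exact key2)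
  convert key3 using 1
  omega

lemma SS_all (n : ℕ) (hn : 4 ≤ n) : ∀ d, SS k n d := by
  induction n, hn using Nat.le_induction with
  | base =>
    intro d
    induction d using Nat.twoStepInduction with
    | zero => 
      refine fun r hr => ⟨by omega, fun m hm => ?_⟩
      obtain rfl : m = 0 := by omega
      exact good_zero r
    | one =>
      refine fun r hr => ⟨by omega, fun m hm => ?_⟩
      obtain rfl : m = 0 := by omega
      exact good_one r
    | more e h0 h1 => exact SS_step k 3 e (step4 k e) h0 h1
  | succ n hn ih =>
    intro d
    induction d using Nat.twoStepInduction with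
    | zero => 
      refine fun r hr => ⟨by omega, fun m hm => ?_⟩
      obtain rfl : m = 0 := by omega
      exact good_zero r
    | one =>
      refine fun r hr => ⟨by omega, fun m hm => ?_⟩
      obtain rfl : m = 0 := by omega
      exact good_one r
    | more e h0 h1 => exact SS_step k n e (step5 k n e hn (ih (e+2))) h0 h1
end


section final
open Module
variable {k : Type} [Field k] {N : ℕ}

lemma mem_vanIdeal {V : Set (Fin N → k)} {F : MvPolynomial (Fin N) k} :
    F ∈ vanIdeal k N V ↔ ∀ v ∈ V, eval v F = 0 := Iff.rfl

lemma taylor {A : Type} [CommRing A] [Algebra k A] (J : Ideal A) (u y : Fin N → A)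
    (hy : ∀ i, y i ∈ J) (F : MvPolynomial (Fin N) k) :
    aeval (fun i => u i + y i) F - aeval u F - ∑ i, y i * aeval u (pderiv i F) ∈ J ^ 2 := by
  induction F using MvPolynomial.induction_on with
  | C r => simp
  | add p q hp hq =>
    have := (J^2).add_mem hp hq
    convert this using 1
    simp only [map_add, mul_add, Finset.sum_add_distrib]
    ring
  | mul_X p j hp =>
    have hs : ∑ i, y i * aeval u (pderiv i p) ∈ J :=
      J.sum_mem fun i _ => J.mul_mem_right _ (hy i)
    have h2 : (∑ i, y i * aeval u (pderiv i p)) * y j ∈ J ^ 2 := by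
      rw [pow_two]; exact Ideal.mul_mem_mul hs (hy j)
    have h3 := (J^2).add_mem ((J^2).mul_mem_right (u j + y j) hp) h2
    convert h3 using 1
    have e1 : ∀ i, y i * aeval u (pderiv i (p * X j)) =
        y i * aeval u (pderiv i p) * u j + (if i = j then y i * aeval u p else 0) := by
      intro i
      rw [Derivation.leibniz, pderiv_X]
      by_cases h : i = j
      · subst h; simp; ring
      · simp [h, Pi.single_apply, Ne.symm h]; ring
    simp only [e1, Finset.sum_add_distrib, ← Finset.sum_mul, map_mul, aeval_X]
    simp
    ring

lemma dv_zero_of_line [Infinite k] {p c : Fin N → k} {F : MvPolynomial (Fin N) k}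
    (h : ∀ x : k, eval (p + x • c) F = 0) : dv p c F = 0 := by
  rw [← lpoly_coeff_one]
  have : lpoly p c F = 0 := by
    apply Polynomial.funext
    intro x
    rw [lpoly_eval, h]; simp
  rw [this]; simp

lemma dv_add_right (p c c' : Fin N → k) (F : MvPolynomial (Fin N) k) :
    dv p (c + c') F = dv p c F + dv p c' F := by
  simp [dv_apply, add_mul, Finset.sum_add_distrib]

lemma dv_smul_right (p c : Fin N → k) (r : k) (F : MvPolynomial (Fin N) k) :
    dv p (r • c) F = r * dv p c F := by
  simp [dv_apply, Finset.mul_sum, mul_assoc]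

lemma van_pair {p a : Fin N → k} {F : MvPolynomial (Fin N) k} :
    F ∈ vanIdeal k N ↑(Submodule.span k {p, a}) ↔ vl F p a := by
  rw [mem_vanIdeal]
  constructor
  · intro h s t
    exact h _ (Submodule.mem_span_pair.2 ⟨s, t, rfl⟩)
  · intro h v hv
    obtain ⟨s, t, rfl⟩ := Submodule.mem_span_pair.1 hv
    exact h s t

lemma indep_zero {p a b c : Fin N → k} (h : LinearIndependent k ![p, a, b, c]) {x y z w : k}
    (h0 : x • p + y • a + z • b + w • c = 0) : x = 0 ∧ y = 0 ∧ z = 0 ∧ w = 0 := by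
  have := Fintype.linearIndependent_iff.1 h ![x, y, z, w] (by
    simp [Fin.sum_univ_four]; exact h0)
  exact ⟨this 0, this 1, this 2, this 3⟩

lemma inf_pair {p a b c : Fin N → k} (h : LinearIndependent k ![p, a, b, c]) :
    Submodule.span k {p, a} ⊓ Submodule.span k {p, b} = Submodule.span k {p} := by
  apply le_antisymm
  · rintro v ⟨h1, h2⟩
    obtain ⟨s, t, rfl⟩ := Submodule.mem_span_pair.1 h1
    obtain ⟨s', t', h3⟩ := Submodule.mem_span_pair.1 h2
    have := indep_zero h (x := s' - s) (y := -t) (z := t') (w := 0) (by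
      have : s' • p + t' • b - (s • p + t • a) = 0 := sub_eq_zero.2 h3
      rw [← this]; module)
    have ht : t = 0 := by simpa using this.2.1
    subst ht
    simpa using Submodule.smul_mem _ s (Submodule.mem_span_singleton_self p)
  · rw [le_inf_iff]
    constructor <;> apply Submodule.span_mono <;> simp

lemma ne_of_indep {p a b c : Fin N → k} (h : LinearIndependent k ![p, a, b, c]) :
    Submodule.span k {p, a} ≠ Submodule.span k {p, b} := by
  intro he
  have h1 : a ∈ Submodule.span k {p, a} := Submodule.subset_span (by simp)
  rw [he] at h1
  obtain ⟨s, t, h3⟩ := Submodule.mem_span_pair.1 h1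
  have := indep_zero h (x := s) (y := -1) (z := t) (w := 0) (by
      have : s • p + t • b - a = 0 := sub_eq_zero.2 h3
      rw [← this]; module)
  simpa using this.2.1

lemma finrank_pair {p a : Fin N → k} (h : LinearIndependent k ![p, a]) :
    finrank k (Submodule.span k {p, a}) = 2 := by
  have := finrank_span_eq_card h
  have hs : Set.range ![p, a] = {p, a} := by
    simp only [Matrix.range_cons, Matrix.range_empty, Set.union_empty, Set.singleton_union]
  rw [hs] at this
  simpa using this

lemma isSundial_of {p a b c : Fin N → k} (h : LinearIndependent k ![p, a, b, c]) :
    IsSundial k N (Submodule.span k {p, a}) (Submodule.span k {p, b})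
      (Submodule.span k {p, a, b, c}) := by
  refine ⟨finrank_pair ?_, finrank_pair ?_, ne_of_indep h, ?_, ?_, ?_⟩
  · refine LinearIndependent.pair_iff.2 fun s t hst => ?_
    have := indep_zero h (x := s) (y := t) (z := 0) (w := 0) (by simpa using hst)
    exact ⟨this.1, this.2.1⟩
  · refine LinearIndependent.pair_iff.2 fun s t hst => ?_
    have := indep_zero h (x := s) (y := 0) (z := t) (w := 0) (by simpa using hst)
    exact ⟨this.1, this.2.2.1⟩
  · rw [inf_pair h]
    exact finrank_span_singleton (h.ne_zero 0)
  · rw [sup_le_iff]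
    constructor <;> apply Submodule.span_mono <;> intro v hv <;> simp at hv ⊢ <;> tauto
  · have := finrank_span_eq_card h
    have hs : Set.range ![p, a, b, c] = {p, a, b, c} := by
      simp only [Matrix.range_cons, Matrix.range_empty, Set.union_empty, Set.singleton_union]
    rw [hs] at this
    simpa using this

lemma mem_sundial [Infinite k] {d : ℕ} {F : MvPolynomial (Fin N) k} (hF : F.IsHomogeneous d)
    {p a b c : Fin N → k} (h : LinearIndependent k ![p, a, b, c]) :
    F ∈ sundialIdeal k N (Submodule.span k {p, a}) (Submodule.span k {p, b})
      (Submodule.span k {p, a, b, c}) ↔ vl F p a ∧ vl F p b ∧ dv p c F = 0 := by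
  unfold sundialIdeal
  rw [inf_pair h, Ideal.mem_inf, Ideal.mem_inf, van_pair, van_pair, and_assoc]
  have hpT : p ∈ Submodule.span k {p, a, b, c} := Submodule.subset_span (by simp)
  have hcT : c ∈ Submodule.span k {p, a, b, c} := Submodule.subset_span (by simp)
  refine and_congr_right fun h1 => and_congr_right fun h2 => ?_
  constructor
  · intro hm
    obtain ⟨G, hG, H, hH, rfl⟩ := Submodule.mem_sup.1 hm
    rw [map_add]
    have g1 : dv p c G = 0 := by
      rw [pow_two] at hG
      refine Submodule.mul_induction_on hG ?_ ?_
      · intro x hx y hy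
        have hx' := hx p (Submodule.mem_span_singleton_self p)
        have hy' := hy p (Submodule.mem_span_singleton_self p)
        change dv p c (x * y) = 0
        rw [dv_mul, hx', hy']; ring
      · intro x y hx hy
        rw [map_add, hx, hy, add_zero]
    have g2 : dv p c H = 0 := by
      apply dv_zero_of_line
      intro x
      exact hH _ (Submodule.add_mem _ hpT (Submodule.smul_mem _ _ hcT))
    rw [g1, g2, add_zero]
  · intro hdv
    have hline : ∀ x : k, eval (x • p) F = 0 := fun x => by simpa using h1 x 0
    have d1 : dv p p F = 0 := dv_zero_of_line fun x => by
      have := hline (1+x)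
      rwa [add_smul, one_smul] at this
    have d2 : dv p a F = 0 := dv_zero_of_line fun x => by simpa using h1 1 x
    have d3 : dv p b F = 0 := dv_zero_of_line fun x => by simpa using h2 1 x
    have dT : ∀ w ∈ Submodule.span k {p, a, b, c}, dv p w F = 0 := by
      intro w hw
      induction hw using Submodule.span_induction with
      | mem x hx =>
        simp only [Set.mem_insert_iff, Set.mem_singleton_iff] at hx
        rcases hx with rfl | rfl | rfl | rfl <;> assumption
      | zero => simp [dv_apply]
      | add x y _ _ hx hy => rw [dv_add_right, hx, hy, add_zero]
      | smul r x _ hx => rw [dv_smul_right, hx, mul_zero]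
    have hp0 : p ≠ 0 := h.ne_zero 0
    obtain ⟨i0, hi0⟩ := Function.ne_iff.1 hp0
    let ℓ : MvPolynomial (Fin N) k := C ((p i0)⁻¹) * X i0
    let u : Fin N → MvPolynomial (Fin N) k := fun i => ℓ * C (p i)
    let y : Fin N → MvPolynomial (Fin N) k := fun i => X i - ℓ * C (p i)
    have hy : ∀ i, y i ∈ vanIdeal k N ↑(Submodule.span k {p}) := by
      intro i v hv
      obtain ⟨s, rfl⟩ := Submodule.mem_span_singleton.1 hv
      have : p i0 ≠ 0 := hi0
      simp [y, ℓ]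
      field_simp
      ring
    have hu : ∀ (G : MvPolynomial (Fin N) k) w, eval w (aeval u G) = eval (eval w ℓ • p) G := by
      intro G w
      have : (eval w).comp (aeval u : _ →ₐ[k] MvPolynomial (Fin N) k).toRingHom
          = eval (eval w ℓ • p) := by
        apply MvPolynomial.ringHom_ext
        · intro r; simp
        · intro i; simp [u]
      exact congrArg (fun f => f G) this
    have ht := taylor _ u y hy F
    have e1 : aeval (fun i => u i + y i) F = F := by
      have : (fun i => u i + y i) = (X : Fin N → MvPolynomial (Fin N) k) := by
        funext i; simp [u, y]
      rw [this]; simp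
    have e2 : aeval u F = 0 := by
      apply MvPolynomial.funext
      intro w
      rw [hu, hline]; simp
    rw [e1, e2, sub_zero] at ht
    refine Submodule.mem_sup.2 ⟨_, ht, ∑ i, y i * aeval u (pderiv i F), ?_, by abel⟩
    intro w hw
    have e3 : eval w (∑ i, y i * aeval u (pderiv i F)) =
        (eval w ℓ) ^ (d-1) * dv p (w + (-(eval w ℓ)) • p) F := by
      rw [dv_apply, map_sum, Finset.mul_sum]
      refine Finset.sum_congr rfl fun i _ => ?_
      rw [map_mul, hu, eval_smul_of_homog hF.pderiv]
      simp [y]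
      ring
    rw [e3, dT _ (Submodule.add_mem _ hw (Submodule.smul_mem _ _ hpT)), mul_zero]

lemma LOpen_det {E : Type} [AddCommGroup E] [Module k E] {r : ℕ} (A : E → Fin r → Fin r → k)
    (hA : ∀ i j, PolyOn k fun e => A e i j) : LOpen k {e | (Matrix.of (A e)).det ≠ 0} := by
  apply LOpen.ne_zero
  have := PolyOn.evalMv (f := fun (p : Fin r × Fin r) e => A e p.1 p.2) (fun p => hA p.1 p.2)
    (Matrix.det (Matrix.mvPolynomialX (Fin r) (Fin r) k))
  convert this using 2 with e
  rw [RingHom.map_det]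
  exact congrArg Matrix.det (Matrix.mvPolynomialX_mapMatrix_eval (Matrix.of (A e))).symm

lemma indep_of_det {r : ℕ} (h : r ≤ N) (v : Fin r → Fin N → k)
    (hd : (Matrix.of fun i j => v i (Fin.castLE h j)).det ≠ 0) : LinearIndependent k v := by
  have := Matrix.linearIndependent_rows_of_det_ne_zero hd
  exact LinearIndependent.of_comp (LinearMap.funLeft k k (Fin.castLE h)) this

lemma det_single {r : ℕ} (h : r ≤ N) :
    (Matrix.of fun i j : Fin r => (Pi.single (Fin.castLE h i) 1 : Fin N → k) (Fin.castLE h j)).det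
      ≠ 0 := by
  have : (Matrix.of fun i j : Fin r =>
      (Pi.single (Fin.castLE h i) 1 : Fin N → k) (Fin.castLE h j)) = 1 := by
    ext i j
    simp [Matrix.one_apply, Pi.single_apply, eq_comm]
  rw [this]; simp

lemma exists_nondeg [Infinite k] {d m l b : ℕ} (hN : 4 ≤ N) (hG : GoodN k N d m l b) :
    ∃ (S : Fin 4 → Fin m → Fin N → k) (L : Fin 2 → Fin l → Fin N → k),
      finrank k (KS d S L) ≤ b ∧ (∀ i, LinearIndependent k fun a => S a i) ∧
      ∀ j, LinearIndependent k fun a => L a j := by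
  have hN2 : 2 ≤ N := by omega
  let E := (Fin 4 → Fin m → Fin N → k) × (Fin 2 → Fin l → Fin N → k)
  let P : Option (Fin m ⊕ Fin l) → Set E := fun o => match o with
    | none => {e | finrank k (KS d e.1 e.2) ≤ b}
    | some (Sum.inl i) => {e | (Matrix.of fun a j => e.1 a i (Fin.castLE hN j)).det ≠ 0}
    | some (Sum.inr i) => {e | (Matrix.of fun a j => e.2 a i (Fin.castLE hN2 j)).det ≠ 0}
  obtain ⟨e, he⟩ := nonempty_iInter_aux (k := k) (P := P) (by
    rintro (_ | i | i)
    · exact LOpen_KS d _ _ b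
    · exact LOpen_det (E := E) (fun e a j => e.1 a i (Fin.castLE hN j)) fun a j =>
        PolyOn.lin ((LinearMap.proj (Fin.castLE hN j)).comp ((LinearMap.proj i).comp
          ((LinearMap.proj a).comp
          (LinearMap.fst k (Fin 4 → Fin m → Fin N → k) (Fin 2 → Fin l → Fin N → k)))))
    · exact LOpen_det (E := E) (fun e a j => e.2 a i (Fin.castLE hN2 j)) fun a j =>
        PolyOn.lin ((LinearMap.proj (Fin.castLE hN2 j)).comp ((LinearMap.proj i).comp
          ((LinearMap.proj a).comp
          (LinearMap.snd k (Fin 4 → Fin m → Fin N → k) (Fin 2 → Fin l → Fin N → k)))))) (by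
    rintro (_ | i | i)
    · obtain ⟨S, L, h⟩ := hG
      exact ⟨(S, L), h⟩
    · exact ⟨(fun a _ => Pi.single (Fin.castLE hN a) 1, 0), det_single hN⟩
    · exact ⟨(0, fun a _ => Pi.single (Fin.castLE hN2 a) 1), det_single hN2⟩)
  rw [Set.mem_iInter] at he
  exact ⟨e.1, e.2, he none, fun i => indep_of_det hN _ (he (some (Sum.inl i))),
    fun i => indep_of_det hN2 _ (he (some (Sum.inr i)))⟩

lemma KS_lower [CharZero k] {n d m l : ℕ} (S : Fin 4 → Fin m → Fin (n+1) → k)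
    (L : Fin 2 → Fin l → Fin (n+1) → k) :
    (d+n).choose n ≤ finrank k (KS d S L) + (m*(2*(d+1)) + l*(d+1)) := by
  have := finrank_drop (M := Rf k (n+1) d)
    (α := (Fin m × (Fin (d+1) ⊕ (Fin d ⊕ Unit))) ⊕ (Fin l × Fin (d+1)))
    (fun α => (Sum.elim (fun z => Sum.elim (fun i : Fin (d+1) =>
        evL (S 0 z.1 + ((i : ℕ) : k) • S 1 z.1))
        (Sum.elim (fun i : Fin d => evL (S 0 z.1 + ((i + 1 : ℕ) : k) • S 2 z.1))
          (fun _ => dv (S 0 z.1) (S 3 z.1))) z.2)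
        (fun z => evL (L 0 z.1 + ((z.2 : ℕ) : k) • L 1 z.1)) α).comp (Submodule.subtype _))
    ⊤ (KS d S L) (by
      intro F _ hz
      rw [mem_KS]
      have h1 : ∀ i, vl F.1 (S 0 i) (S 1 i) := fun i =>
        vl_of_points F.2 fun j => hz (Sum.inl (i, Sum.inl j))
      refine ⟨h1, fun i => vl_of_points F.2 fun j => ?_, fun i =>
        vl_of_points F.2 fun j => hz (Sum.inr (i, j)), fun i =>
        hz (Sum.inl (i, Sum.inr (Sum.inr ())))⟩
      refine Fin.cases ?_ (fun j => ?_) j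
      · simpa using (h1 i).left
      · exact hz (Sum.inl (i, Sum.inr (Sum.inl j))))
  rw [finrank_top, finrank_Rf] at this
  simp only [Fintype.card_sum, Fintype.card_prod, Fintype.card_fin, Fintype.card_unit] at this
  rw [show d+1+(d+1) = 2*(d+1) by ring] at this
  exact this

lemma final_exists [CharZero k] {n d r : ℕ} (hn : 4 ≤ n) (hr : 2*(d-1) ≤ r) (hd : 1 ≤ d)
    (hG : GoodN k (n+1) d (d-1) (r-2*(d-1)) ((d+n).choose n - r*(d+1))) :
    ∃ (V₁ V₂ T : Fin (d-1) → Submodule k (Fin (n+1) → k))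
      (M : Fin (r - 2*(d-1)) → Submodule k (Fin (n+1) → k)),
      (∀ i, IsSundial k (n+1) (V₁ i) (V₂ i) (T i)) ∧
      (∀ j, Module.finrank k (M j) = 2) ∧
      hdim k (n+1) ((⨅ i, sundialIdeal k (n+1) (V₁ i) (V₂ i) (T i)) ⊓
          ⨅ j, vanIdeal k (n+1) ↑(M j)) d ≤ (d+n).choose n - r*(d+1) ∧
      (d+n).choose n ≤ hdim k (n+1) ((⨅ i, sundialIdeal k (n+1) (V₁ i) (V₂ i) (T i)) ⊓
          ⨅ j, vanIdeal k (n+1) ↑(M j)) d + r*(d+1) := by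
  obtain ⟨S, L, h1, h2, h3⟩ := exists_nondeg (by omega) hG
  have h2' : ∀ i, LinearIndependent k ![S 0 i, S 1 i, S 2 i, S 3 i] := by
    intro i
    convert h2 i using 1
    funext a; fin_cases a <;> rfl
  have h3' : ∀ i, LinearIndependent k ![L 0 i, L 1 i] := by
    intro i
    convert h3 i using 1
    funext a; fin_cases a <;> rfl
  refine ⟨fun i => Submodule.span k {S 0 i, S 1 i}, fun i => Submodule.span k {S 0 i, S 2 i},
    fun i => Submodule.span k {S 0 i, S 1 i, S 2 i, S 3 i},
    fun j => Submodule.span k {L 0 j, L 1 j}, fun i => isSundial_of (h2' i),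
    fun j => finrank_pair (h3' j), ?_⟩
  have key : hdim k (n+1) ((⨅ i, sundialIdeal k (n+1) (Submodule.span k {S 0 i, S 1 i})
      (Submodule.span k {S 0 i, S 2 i}) (Submodule.span k {S 0 i, S 1 i, S 2 i, S 3 i})) ⊓
      ⨅ j, vanIdeal k (n+1) ↑(Submodule.span k {L 0 j, L 1 j})) d = finrank k (KS d S L) := by
    unfold hdim
    rw [← Submodule.finrank_map_subtype_eq (homogeneousSubmodule (Fin (n+1)) k d) (KS d S L)]
    refine congrArg (fun W : Submodule k (MvPolynomial (Fin (n+1)) k) => finrank k W) ?_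
    apply le_antisymm
    · rintro F ⟨hF, hFd⟩
      refine ⟨⟨F, hFd⟩, ?_, rfl⟩
      have hF1 := (Ideal.mem_inf.1 hF).1
      have hF2 := (Ideal.mem_inf.1 hF).2
      rw [Ideal.mem_iInf] at hF1 hF2
      have hF3 := fun i => (mem_sundial hFd (h2' i)).1 (hF1 i)
      change _ ∈ KS d S L
      rw [mem_KS]
      exact ⟨fun i => (hF3 i).1, fun i => (hF3 i).2.1, fun j => van_pair.1 (hF2 j),
        fun i => (hF3 i).2.2⟩
    · rintro _ ⟨F, hF, rfl⟩
      have hF' : F ∈ KS d S L := hF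
      rw [mem_KS] at hF'
      refine ⟨?_, F.2⟩
      refine Ideal.mem_inf.2 ⟨?_, ?_⟩
      · rw [Ideal.mem_iInf]
        exact fun i => (mem_sundial F.2 (h2' i)).2 ⟨hF'.1 i, hF'.2.1 i, hF'.2.2.2 i⟩
      · rw [Ideal.mem_iInf]
        exact fun j => van_pair.2 (hF'.2.2.1 j)
  rw [key]
  refine ⟨h1, ?_⟩
  have := KS_lower (d := d) S L
  obtain ⟨j, hj⟩ := Nat.exists_eq_add_of_le hr
  have e1 : (d-1)*(2*(d+1)) + (r-2*(d-1))*(d+1) = r*(d+1) := by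
    rw [show r - 2*(d-1) = j by omega, hj]; ring
  rwa [e1] at this

end final

/-- Lemma 4.7 of the paper: statements `S(n,d)` and `S*(n,d)` hold for all
`n ≥ 4`, i.e. `d−1` generic sundials together with `t−2(d−1)` (resp. `t*−2(d−1)`)
generic lines in `ℙ^n` impose the expected number of conditions on degree-`d`
forms. -/
theorem stmt14 (k : Type) [Field k] [IsAlgClosed k] [CharZero k]
    (n d t ts : ℕ) (hn : 4 ≤ n) (hd : 1 ≤ d)
    (ht : t = (d+n).choose n / (d+1)) (hts : ts = ((d+n).choose n + d) / (d+1)) :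
    2*(d-1) ≤ t ∧
    (∃ (V₁ V₂ T : Fin (d-1) → Submodule k (Fin (n+1) → k))
      (M : Fin (t - 2*(d-1)) → Submodule k (Fin (n+1) → k)),
      (∀ i, IsSundial k (n+1) (V₁ i) (V₂ i) (T i)) ∧
      (∀ j, Module.finrank k (M j) = 2) ∧
      (hdim k (n+1) ((⨅ i, sundialIdeal k (n+1) (V₁ i) (V₂ i) (T i)) ⊓
          ⨅ j, vanIdeal k (n+1) ↑(M j)) d : ℤ)
        = ((d+n).choose n : ℤ) - t * (d+1)) ∧
    (∃ (V₁ V₂ T : Fin (d-1) → Submodule k (Fin (n+1) → k))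
      (M : Fin (ts - 2*(d-1)) → Submodule k (Fin (n+1) → k)),
      (∀ i, IsSundial k (n+1) (V₁ i) (V₂ i) (T i)) ∧
      (∀ j, Module.finrank k (M j) = 2) ∧
      hdim k (n+1) ((⨅ i, sundialIdeal k (n+1) (V₁ i) (V₂ i) (T i)) ⊓
        ⨅ j, vanIdeal k (n+1) ↑(M j)) d = 0) := by
  have hS := SS_all k n hn d
  obtain ⟨t1, t2⟩ := hS t (Or.inl ht)
  obtain ⟨s1, s2⟩ := hS ts (Or.inr hts)
  refine ⟨t1, ?_, ?_⟩
  · obtain ⟨V₁, V₂, T, M, a1, a2, a3, a4⟩ := final_exists hn t1 hd (t2 (d-1) le_rfl)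
    refine ⟨V₁, V₂, T, M, a1, a2, ?_⟩
    have h1 : t*(d+1) ≤ (d+n).choose n := by rw [ht]; exact Nat.div_mul_le_self _ _
    zify [h1] at a3 a4
    linarith
  · obtain ⟨V₁, V₂, T, M, a1, a2, a3, a4⟩ := final_exists hn s1 hd (s2 (d-1) le_rfl)
    refine ⟨V₁, V₂, T, M, a1, a2, ?_⟩
    have h3 := Nat.div_add_mod ((d+n).choose n + d) (d+1)
    have h4 := Nat.mod_lt ((d+n).choose n + d) (show 0 < d+1 by omega)
    rw [mul_comm, ← hts] at h3
    omega
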